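/- Let θ be a root of f_1(x) = x^4 + 2x^2 − 1 (irreducible over ℚ) and K_1 = ℚ(θ). Let E_1 be the elliptic curve over K_1 given by Y^2 = X(X^2 − (θ + θ^2)X + (1 + θ + θ^3)), and let G_1 = ((3 + 4θ + θ^2)/2, (−4 − 6θ − θ^2 − 5θ^3)/2) ∈ E_1(K_1). Then the affine points (X,Y) ∈ E_1(K_1) for which −θ + (3 − 3θ + θ^2 − θ^3)·X is a rational number are exactly the two points G_1 and −G_1. -/

import Mathlib

open Polynomial

/-- The elliptic curve `𝓔₁ : Y² = X (X² − (θ + θ²) X + (1 + θ + θ³))` over a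
field containing an element `θ`. -/
def E1 {K : Type*} [Field K] (θ : K) : WeierstrassCurve.Affine K :=
  { a₁ := 0, a₂ := -(θ + θ ^ 2), a₃ := 0, a₄ := 1 + θ + θ ^ 3, a₆ := 0 }

namespace ThetaField

section QuarticField

open NumberField

variable {K : Type*} [Field K] {θ : K}

section Algebra

variable [Algebra ℚ K]

theorem monic_quartic : (X ^ 4 + 2 * X ^ 2 - 1 : ℚ[X]).Monic := by
  monicity!

theorem natDegree_quartic : (X ^ 4 + 2 * X ^ 2 - 1 : ℚ[X]).natDegree = 4 := by
  compute_degree!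

theorem aeval_quartic (hθ : θ ^ 4 + 2 * θ ^ 2 - 1 = 0) :
    aeval θ (X ^ 4 + 2 * X ^ 2 - 1 : ℚ[X]) = 0 := by
  simpa [map_ofNat] using hθ

theorem minpoly_eq (hirr : Irreducible (X ^ 4 + 2 * X ^ 2 - 1 : ℚ[X]))
    (hθ : θ ^ 4 + 2 * θ ^ 2 - 1 = 0) : minpoly ℚ θ = X ^ 4 + 2 * X ^ 2 - 1 :=
  (minpoly.eq_of_irreducible_of_monic hirr (aeval_quartic hθ) monic_quartic).symm

/-- The power basis `1, θ, θ², θ³` of `ℚ(θ)`. -/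
noncomputable def powerBasis (hirr : Irreducible (X ^ 4 + 2 * X ^ 2 - 1 : ℚ[X]))
    (hθ : θ ^ 4 + 2 * θ ^ 2 - 1 = 0) (hgen : Algebra.adjoin ℚ {θ} = ⊤) : PowerBasis ℚ K :=
  have hint : IsIntegral ℚ θ := ⟨_, monic_quartic, aeval_quartic hθ⟩
  let B := PowerBasis.ofAdjoinEqTop hint hgen
  have hdim : B.dim = 4 := by
    rw [PowerBasis.ofAdjoinEqTop_dim, minpoly_eq hirr hθ, natDegree_quartic]
  { gen := θ
    dim := 4
    basis := B.basis.reindex (finCongr hdim)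
    basis_eq_pow := by
      intro i
      rw [Module.Basis.reindex_apply, B.basis_eq_pow, PowerBasis.ofAdjoinEqTop_gen]
      simp }

theorem leftMulMatrix_powerBasis (hirr : Irreducible (X ^ 4 + 2 * X ^ 2 - 1 : ℚ[X]))
    (hθ : θ ^ 4 + 2 * θ ^ 2 - 1 = 0) (hgen : Algebra.adjoin ℚ {θ} = ⊤) :
    Algebra.leftMulMatrix (powerBasis hirr hθ hgen).basis θ =
      !![0, 0, 0, 1; 1, 0, 0, 0; 0, 1, 0, -2; 0, 0, 1, 0] := by
  let b : Module.Basis (Fin 4) ℚ K := (powerBasis hirr hθ hgen).basis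
  have hb (i : Fin 4) : b i = θ ^ (i : ℕ) := (powerBasis hirr hθ hgen).basis_eq_pow i
  have h0 : θ * b 0 = b 1 := by simp [hb]
  have h1 : θ * b 1 = b 2 := by simp [hb]; ring
  have h2 : θ * b 2 = b 3 := by simp [hb]; ring
  have h3 : θ * b 3 = b 0 - (2 : ℚ) • b 2 := by
    simp [hb, Algebra.smul_def]
    linear_combination hθ
  change Algebra.leftMulMatrix b θ = _
  ext i j
  rw [Algebra.leftMulMatrix_eq_repr_mul]
  fin_cases j
  · fin_cases i <;> simp [h0]
  · fin_cases i <;> simp [h1]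
  · fin_cases i <;> simp [h2]
  · fin_cases i <;> simp [h3]

theorem discr_powerBasis (hirr : Irreducible (X ^ 4 + 2 * X ^ 2 - 1 : ℚ[X]))
    (hθ : θ ^ 4 + 2 * θ ^ 2 - 1 = 0) (hgen : Algebra.adjoin ℚ {θ} = ⊤) :
    Algebra.discr ℚ (powerBasis hirr hθ hgen).basis = -1024 := by
  let b : Module.Basis (Fin 4) ℚ K := (powerBasis hirr hθ hgen).basis
  have hb (i : Fin 4) : b i = θ ^ (i : ℕ) := (powerBasis hirr hθ hgen).basis_eq_pow i
  have hM : Algebra.leftMulMatrix b θ = !![0, 0, 0, 1; 1, 0, 0, 0; 0, 1, 0, -2; 0, 0, 1, 0] :=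
    leftMulMatrix_powerBasis hirr hθ hgen
  have htr (n : ℕ) : Algebra.trace ℚ K (θ ^ n) =
      Matrix.trace (!![0, 0, 0, 1; 1, 0, 0, 0; 0, 1, 0, -2; 0, 0, 1, 0] ^ n : Matrix _ _ ℚ) := by
    rw [Algebra.trace_eq_matrix_trace b, map_pow, hM]
  have hmat : Algebra.traceMatrix ℚ b =
      !![4, 0, -4, 0; 0, -4, 0, 12; -4, 0, 12, 0; 0, 12, 0, -28] := by
    ext i j
    rw [Algebra.traceMatrix_apply, Algebra.traceForm_apply, hb, hb, ← pow_add, htr]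
    fin_cases i <;> fin_cases j <;>
      simp [pow_succ, Matrix.trace, Fin.sum_univ_succ] <;> norm_num
  change Algebra.discr ℚ b = _
  rw [Algebra.discr_def, hmat]
  simp [Matrix.det_succ_row_zero, Fin.sum_univ_succ, Fin.succAbove]
  norm_num

end Algebra

theorem isIntegral_theta (hθ : θ ^ 4 + 2 * θ ^ 2 - 1 = 0) : IsIntegral ℤ θ :=
  ⟨X ^ 4 + 2 * X ^ 2 - 1, by monicity!, by simpa using hθ⟩

theorem minpoly_add_one [CharZero K] (hirr : Irreducible (X ^ 4 + 2 * X ^ 2 - 1 : ℚ[X]))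
    (hθ : θ ^ 4 + 2 * θ ^ 2 - 1 = 0) :
    minpoly ℤ (θ + 1) = X ^ 4 - 4 * X ^ 3 + 8 * X ^ 2 - 8 * X + 2 := by
  have hint : IsIntegral ℤ (θ + 1) := (isIntegral_theta hθ).add isIntegral_one
  apply map_injective (algebraMap ℤ ℚ) (algebraMap ℤ ℚ).injective_int
  rw [← minpoly.isIntegrallyClosed_eq_field_fractions' ℚ hint,
    ← map_one (algebraMap ℚ K), minpoly.add_algebraMap, minpoly_eq hirr hθ]
  simp
  ring

theorem isEisensteinAt_two :
    (X ^ 4 - 4 * X ^ 3 + 8 * X ^ 2 - 8 * X + 2 : ℤ[X]).IsEisensteinAt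
      (Submodule.span ℤ {(2 : ℤ)}) := by
  have hd : (X ^ 4 - 4 * X ^ 3 + 8 * X ^ 2 - 8 * X + 2 : ℤ[X]).natDegree = 4 := by
    compute_degree!
  have hc : (X ^ 4 - 4 * X ^ 3 + 8 * X ^ 2 - 8 * X + 2 : ℤ[X]) =
      X ^ 4 - C 4 * X ^ 3 + C 8 * X ^ 2 - C 8 * X + C 2 := by simp [map_ofNat]
  refine ⟨?_, fun {n} hn => ?_, ?_⟩
  · rw [leadingCoeff, hd, hc]
    simp [coeff_X, Ideal.mem_span_singleton]
  · rw [hd] at hn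
    rw [hc]
    interval_cases n <;> simp [coeff_X, coeff_X_pow, Ideal.mem_span_singleton]
  · rw [hc, Ideal.submodule_span_eq, Ideal.span_singleton_pow]
    simp [coeff_X, Ideal.mem_span_singleton]

variable [NumberField K]

theorem mem_adjoin_of_isIntegral (hirr : Irreducible (X ^ 4 + 2 * X ^ 2 - 1 : ℚ[X]))
    (hθ : θ ^ 4 + 2 * θ ^ 2 - 1 = 0) (hgen : Algebra.adjoin ℚ {θ} = ⊤) {z : K}
    (hz : IsIntegral ℤ z) : z ∈ Algebra.adjoin ℤ {θ} := by
  have hadd : ∀ (A : Type) [CommRing A] [Algebra A K],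
      Algebra.adjoin A {θ + 1} = Algebra.adjoin A {θ} := by
    intro A _ _
    apply le_antisymm <;> rw [Algebra.adjoin_le_iff, Set.singleton_subset_iff]
    · exact add_mem (Algebra.self_mem_adjoin_singleton A θ) (one_mem _)
    · have := sub_mem (Algebra.self_mem_adjoin_singleton A (θ + 1)) (one_mem _)
      simpa using this
  have hint : IsIntegral ℤ (θ + 1) := (isIntegral_theta hθ).add isIntegral_one
  have hdisc : Algebra.discr ℚ (powerBasis hirr hθ hgen).basis • z ∈ Algebra.adjoin ℤ {θ} :=
    Algebra.discr_mul_isIntegral_mem_adjoin (B := powerBasis hirr hθ hgen) ℚ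
      (isIntegral_theta hθ) hz
  rw [discr_powerBasis] at hdisc
  let B := PowerBasis.ofAdjoinEqTop (K := ℚ) (x := θ + 1) hint.tower_top ((hadd ℚ).trans hgen)
  have hB : B.gen = θ + 1 := PowerBasis.ofAdjoinEqTop_gen _ _
  have hpow : (2 : ℤ) ^ 10 • z ∈ Algebra.adjoin ℤ {B.gen} := by
    rw [hB, hadd ℤ]
    have := neg_mem hdisc
    convert this using 1
    simp [Algebra.smul_def]
  have := mem_adjoin_of_smul_prime_pow_smul_of_minpoly_isEisensteinAt (B := B)
    Int.prime_two (by rwa [hB]) hz hpow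
    (by rw [hB, minpoly_add_one hirr hθ]; exact isEisensteinAt_two)
  rwa [hB, hadd ℤ] at this

/-- Every algebraic integer of `ℚ(θ)` has integral coordinates in `1, θ, θ², θ³`. -/
theorem exists_coords (hirr : Irreducible (X ^ 4 + 2 * X ^ 2 - 1 : ℚ[X])) {θ : 𝓞 K}
    (hθ : θ ^ 4 + 2 * θ ^ 2 - 1 = 0) (hgen : Algebra.adjoin ℚ {(θ : K)} = ⊤) (z : 𝓞 K) :
    ∃ a b c d : ℤ, z = a + b * θ + c * θ ^ 2 + d * θ ^ 3 := by
  have hθK : (θ : K) ^ 4 + 2 * (θ : K) ^ 2 - 1 = 0 := by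
    simpa [map_ofNat] using congrArg (algebraMap (𝓞 K) K) hθ
  have hz := mem_adjoin_of_isIntegral hirr hθK hgen z.isIntegral_coe
  suffices ∀ w ∈ Algebra.adjoin ℤ {(θ : K)},
      ∃ a b c d : ℤ, w = a + b * θ + c * θ ^ 2 + d * θ ^ 3 by
    obtain ⟨a, b, c, d, h⟩ := this _ hz
    exact ⟨a, b, c, d, by apply RingOfIntegers.coe_injective; simpa using h⟩
  intro w hw
  induction hw using Algebra.adjoin_induction with
  | mem x hx => exact ⟨0, 1, 0, 0, by simp [Set.mem_singleton_iff.1 hx]⟩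
  | algebraMap r => exact ⟨r, 0, 0, 0, by simp⟩
  | add x y _ _ hx hy =>
    obtain ⟨a, b, c, d, rfl⟩ := hx
    obtain ⟨a', b', c', d', rfl⟩ := hy
    exact ⟨a + a', b + b', c + c', d + d', by push_cast; ring⟩
  | mul x y _ _ hx hy =>
    obtain ⟨a, b, c, d, rfl⟩ := hx
    obtain ⟨a', b', c', d', rfl⟩ := hy
    refine ⟨a * a' + (b * d' + c * c' + d * b') - 2 * (d * d'),
      a * b' + b * a' + (c * d' + d * c'),
      a * c' + b * b' + c * a' - 2 * (b * d' + c * c' + d * b') + 5 * (d * d'),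
      a * d' + b * c' + c * b' + d * a' - 2 * (c * d' + d * c'), ?_⟩
    push_cast
    linear_combination ((b * d' + c * c' + d * b') + (c * d' + d * c') * θ
      + d * d' * (θ ^ 2 - 2)) * hθK

theorem coords_eq_zero (hirr : Irreducible (X ^ 4 + 2 * X ^ 2 - 1 : ℚ[X])) {θ : 𝓞 K}
    (hθ : θ ^ 4 + 2 * θ ^ 2 - 1 = 0) {a b c d : ℤ}
    (h : a + b * θ + c * θ ^ 2 + d * θ ^ 3 = 0) : a = 0 ∧ b = 0 ∧ c = 0 ∧ d = 0 := by
  have hθK : (θ : K) ^ 4 + 2 * (θ : K) ^ 2 - 1 = 0 := by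
    simpa [map_ofNat] using congrArg (algebraMap (𝓞 K) K) hθ
  have hli := linearIndependent_pow (K := ℚ) (θ : K)
  rw [minpoly_eq hirr hθK, natDegree_quartic, Fintype.linearIndependent_iff] at hli
  have hK : (a : K) + b * θ + c * (θ : K) ^ 2 + d * (θ : K) ^ 3 = 0 := by
    simpa using congrArg (algebraMap (𝓞 K) K) h
  have := hli ![a, b, c, d] (by
    simp [Fin.sum_univ_succ, Algebra.smul_def]
    linear_combination hK)
  exact ⟨by simpa using this 0, by simpa using this 1, by simpa using this 2,
    by simpa using this 3⟩

/-- The integral basis `1, θ, θ², θ³` of the ring of integers of `ℚ(θ)`. -/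
noncomputable def integersBasis (hirr : Irreducible (X ^ 4 + 2 * X ^ 2 - 1 : ℚ[X])) {θ : 𝓞 K}
    (hθ : θ ^ 4 + 2 * θ ^ 2 - 1 = 0) (hgen : Algebra.adjoin ℚ {(θ : K)} = ⊤) :
    Module.Basis (Fin 4) ℤ (𝓞 K) :=
  Module.Basis.mk (v := fun i : Fin 4 => θ ^ (i : ℕ))
    (by
      rw [Fintype.linearIndependent_iff]
      intro g hg
      simp only [Fin.sum_univ_succ, zsmul_eq_mul] at hg
      obtain ⟨h0, h1, h2, h3⟩ := coords_eq_zero hirr hθ (a := g 0) (b := g 1) (c := g 2) (d := g 3)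
        (by simpa [add_assoc] using hg)
      intro i
      fin_cases i <;> assumption)
    (by
      intro z _
      obtain ⟨a, b, c, d, rfl⟩ := exists_coords hirr hθ hgen z
      have h (i : Fin 4) (n : ℤ) : n * θ ^ (i : ℕ) ∈
          Submodule.span ℤ (Set.range fun i : Fin 4 => θ ^ (i : ℕ)) := by
        rw [← zsmul_eq_mul]
        exact Submodule.smul_mem _ _ (Submodule.subset_span ⟨i, rfl⟩)
      have := add_mem (add_mem (add_mem (h 0 a) (h 1 b)) (h 2 c)) (h 3 d)
      simpa using this)

theorem discr_eq (hirr : Irreducible (X ^ 4 + 2 * X ^ 2 - 1 : ℚ[X])) {θ : 𝓞 K}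
    (hθ : θ ^ 4 + 2 * θ ^ 2 - 1 = 0) (hgen : Algebra.adjoin ℚ {(θ : K)} = ⊤) :
    discr K = -1024 := by
  have hθK : (θ : K) ^ 4 + 2 * (θ : K) ^ 2 - 1 = 0 := by
    simpa [map_ofNat] using congrArg (algebraMap (𝓞 K) K) hθ
  have h := Algebra.discr_localizationLocalization ℤ (nonZeroDivisors ℤ) K (Rₘ := ℚ)
    (integersBasis hirr hθ hgen)
  rw [NumberField.discr_eq_discr] at h
  have hb : ((integersBasis hirr hθ hgen).localizationLocalization ℚ (nonZeroDivisors ℤ) K :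
      Fin 4 → K) = (powerBasis hirr hθK hgen).basis := by
    funext i
    refine Eq.trans ?_ ((powerBasis hirr hθK hgen).basis_eq_pow i).symm
    rw [Module.Basis.localizationLocalization_apply]
    simp [integersBasis, powerBasis]
  rw [hb] at h
  have h' := h.symm.trans (discr_powerBasis hirr hθK hgen)
  have : ((discr K : ℤ) : ℚ) = ((-1024 : ℤ) : ℚ) := by simpa using h'
  exact_mod_cast this

theorem finrank_eq_four (hirr : Irreducible (X ^ 4 + 2 * X ^ 2 - 1 : ℚ[X]))
    (hθ : θ ^ 4 + 2 * θ ^ 2 - 1 = 0) (hgen : Algebra.adjoin ℚ {θ} = ⊤) :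
    Module.finrank ℚ K = 4 :=
  (powerBasis hirr hθ hgen).finrank

theorem nrComplexPlaces_eq_one (hrank : Module.finrank ℚ K = 4) (hdiscr : discr K = -1024) :
    InfinitePlace.nrComplexPlaces K = 1 := by
  have h1 := InfinitePlace.card_add_two_mul_card_eq_rank K
  have h2 := sign_discr K
  rw [hdiscr] at h2
  rw [hrank] at h1
  have h3 : InfinitePlace.nrComplexPlaces K ≤ 2 := by omega
  interval_cases InfinitePlace.nrComplexPlaces K
  · exact absurd h2 (by decide)
  · rfl
  · exact absurd h2 (by decide)

theorem units_rank_eq_two (hrank : Module.finrank ℚ K = 4) (hdiscr : discr K = -1024) :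
    Units.rank K = 2 := by
  have h1 := InfinitePlace.card_add_two_mul_card_eq_rank K
  have h2 := nrComplexPlaces_eq_one hrank hdiscr
  rw [Units.rank, InfinitePlace.card_eq_nrRealPlaces_add_nrComplexPlaces]
  omega

section Parity

variable {R : Type*} [CommRing R] {θ : R}

theorem two_eq_sub_one_pow_four (hθ : θ ^ 4 + 2 * θ ^ 2 - 1 = 0) :
    2 = (θ - 1) ^ 4 * (53 + 82 * θ + 22 * θ ^ 2 + 34 * θ ^ 3) := by
  linear_combination (-34 * θ ^ 3 + 114 * θ ^ 2 - 130 * θ + 51) * hθ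

theorem sub_one_dvd_two (hθ : θ ^ 4 + 2 * θ ^ 2 - 1 = 0) : θ - 1 ∣ 2 :=
  (dvd_pow_self (θ - 1) four_ne_zero).trans ⟨_, two_eq_sub_one_pow_four hθ⟩

end Parity

theorem sub_one_dvd_or (hirr : Irreducible (X ^ 4 + 2 * X ^ 2 - 1 : ℚ[X])) {θ : 𝓞 K}
    (hθ : θ ^ 4 + 2 * θ ^ 2 - 1 = 0) (hgen : Algebra.adjoin ℚ {(θ : K)} = ⊤) (x : 𝓞 K) :
    θ - 1 ∣ x ∨ θ - 1 ∣ x - 1 := by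
  obtain ⟨a, b, c, d, rfl⟩ := exists_coords hirr hθ hgen x
  have h : θ - 1 ∣ (a + b * θ + c * θ ^ 2 + d * θ ^ 3 : 𝓞 K) - (a + b + c + d : ℤ) :=
    ⟨b + c * (θ + 1) + d * (θ ^ 2 + θ + 1), by push_cast; ring⟩
  obtain ⟨k, hk | hk⟩ := Int.even_or_odd' (a + b + c + d)
  · left
    rw [← sub_add_cancel (a + b * θ + c * θ ^ 2 + d * θ ^ 3 : 𝓞 K) ((a + b + c + d : ℤ) : 𝓞 K)]
    refine dvd_add h ?_
    rw [hk]
    push_cast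
    exact (sub_one_dvd_two hθ).mul_right _
  · right
    have := dvd_add h ((sub_one_dvd_two hθ).mul_right (k : 𝓞 K))
    rw [hk] at this
    convert this using 1
    push_cast
    ring

theorem not_isUnit_sub_one (hirr : Irreducible (X ^ 4 + 2 * X ^ 2 - 1 : ℚ[X])) {θ : 𝓞 K}
    (hθ : θ ^ 4 + 2 * θ ^ 2 - 1 = 0) (hgen : Algebra.adjoin ℚ {(θ : K)} = ⊤) :
    ¬ IsUnit (θ - 1) := by
  intro h
  have h1 := h.pow 4
  have h2 : IsUnit (1 - 2 * θ + 2 * θ ^ 2 - 2 * θ ^ 3) := IsUnit.of_mul_eq_one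
    (53 + 82 * θ + 22 * θ ^ 2 + 34 * θ ^ 3)
    (by linear_combination (-68 * θ ^ 2 + 24 * θ - 52) * hθ)
  have h3 : IsUnit (2 : 𝓞 K) := by
    have : (θ - 1) ^ 4 = 2 * (1 - 2 * θ + 2 * θ ^ 2 - 2 * θ ^ 3) := by linear_combination hθ
    rw [this] at h1
    exact isUnit_of_mul_isUnit_left h1
  obtain ⟨y, hy⟩ := h3.exists_right_inv
  obtain ⟨a, b, c, d, rfl⟩ := exists_coords hirr hθ hgen y
  have := coords_eq_zero hirr hθ (a := 2 * a - 1) (b := 2 * b) (c := 2 * c) (d := 2 * d)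
    (by push_cast; linear_combination hy)
  omega

theorem prime_sub_one (hirr : Irreducible (X ^ 4 + 2 * X ^ 2 - 1 : ℚ[X])) {θ : 𝓞 K}
    (hθ : θ ^ 4 + 2 * θ ^ 2 - 1 = 0) (hgen : Algebra.adjoin ℚ {(θ : K)} = ⊤) :
    Prime (θ - 1) := by
  refine ⟨fun h => ?_, not_isUnit_sub_one hirr hθ hgen, fun x y hxy => ?_⟩
  · have := two_eq_sub_one_pow_four hθ
    rw [h] at this
    norm_num at this
  · by_contra! hc
    have hx := (sub_one_dvd_or hirr hθ hgen x).resolve_left hc.1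
    have hy := (sub_one_dvd_or hirr hθ hgen y).resolve_left hc.2
    refine not_isUnit_sub_one hirr hθ hgen (isUnit_of_dvd_one ?_)
    have h1 := dvd_sub hxy (dvd_add (hx.mul_right y) hy)
    convert h1 using 1
    ring

theorem isPrincipalIdealRing (hirr : Irreducible (X ^ 4 + 2 * X ^ 2 - 1 : ℚ[X])) {θ : 𝓞 K}
    (hθ : θ ^ 4 + 2 * θ ^ 2 - 1 = 0) (hgen : Algebra.adjoin ℚ {(θ : K)} = ⊤) :
    IsPrincipalIdealRing (𝓞 K) := by
  have hθK : (θ : K) ^ 4 + 2 * (θ : K) ^ 2 - 1 = 0 := by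
    simpa [map_ofNat] using congrArg (algebraMap (𝓞 K) K) hθ
  have hrank := finrank_eq_four hirr hθK hgen
  have hdiscr := discr_eq hirr hθ hgen
  apply RingOfIntegers.isPrincipalIdealRing_of_isPrincipal_of_norm_le_of_isPrime
  rintro ⟨P, hP0⟩ hP hN
  change P.IsPrime at hP
  change (Ideal.absNorm P : ℝ) ≤ _ at hN
  change P.IsPrincipal
  have hN3 : Ideal.absNorm P < 4 := by
    rw [nrComplexPlaces_eq_one hrank hdiscr, hrank, hdiscr] at hN
    have h32 : √|((-1024 : ℤ) : ℝ)| = 32 := by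
      rw [Real.sqrt_eq_iff_mul_self_eq (abs_nonneg _) (by norm_num)]
      norm_num
    rw [h32] at hN
    have hpi := Real.pi_gt_d2
    have h4 : 4 / Real.pi < 4 / 3.14 := by gcongr
    have : (Ideal.absNorm P : ℝ) < 4 := by
      refine hN.trans_lt ?_
      have : ((4 : ℕ).factorial : ℝ) / ((4 : ℕ) : ℝ) ^ 4 * 32 = 3 := by
        norm_num [Nat.factorial]
      rw [this, pow_one]
      linarith
    exact_mod_cast this
  have hmem := Ideal.absNorm_mem P
  have hpos : Ideal.absNorm P ≠ 0 := by
    rw [Ne, Ideal.absNorm_eq_zero_iff]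
    exact nonZeroDivisors.ne_zero hP0
  have hne1 : Ideal.absNorm P ≠ 1 := fun h => hP.ne_top (Ideal.absNorm_eq_one_iff.1 h)
  have h23 : Ideal.absNorm P = 2 ∨ Ideal.absNorm P = 3 := by omega
  obtain h | h := h23
  · rw [h] at hmem
    have hπ : θ - 1 ∈ P := by
      refine hP.mem_of_pow_mem 4 ?_
      have : (θ - 1) ^ 4 = (1 - 2 * θ + 2 * θ ^ 2 - 2 * θ ^ 3) * (2 : ℕ) := by
        push_cast
        linear_combination hθ
      rw [this]
      exact P.mul_mem_left _ hmem
    refine ⟨θ - 1, le_antisymm (fun x hx => ?_) ((Ideal.span_singleton_le_iff_mem P).2 hπ)⟩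
    refine Ideal.mem_span_singleton.2 ((sub_one_dvd_or hirr hθ hgen x).resolve_right fun hx1 => ?_)
    refine hP.ne_top ((Ideal.eq_top_iff_one P).2 ?_)
    have := P.sub_mem hx (P.mem_of_dvd hx1 hπ)
    simpa using this
  · exfalso
    rw [h] at hmem
    have hcard : Nat.card (𝓞 K ⧸ P) = 3 := by
      rw [← h, Ideal.absNorm_apply]; rfl
    have : Finite (𝓞 K ⧸ P) := Nat.finite_of_card_ne_zero (by omega)
    have : Fintype (𝓞 K ⧸ P) := Fintype.ofFinite _
    have hF : ∀ x : 𝓞 K, x ^ 3 - x ∈ P := by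
      intro x
      let := (Finite.isField_of_domain (𝓞 K ⧸ P)).toField
      have h3 := FiniteField.pow_card (Ideal.Quotient.mk P x)
      rw [← Nat.card_eq_fintype_card, hcard] at h3
      rw [← Ideal.Quotient.eq_zero_iff_mem, map_sub, map_pow]
      exact sub_eq_zero.2 h3
    refine hP.ne_top ((Ideal.eq_top_iff_one P).2 ?_)
    have h1 := P.add_mem (P.mul_mem_left θ (hF θ)) (P.mul_mem_left (θ ^ 2) hmem)
    convert h1 using 1
    push_cast
    linear_combination - hθ

/-- The coordinates modulo four of an algebraic integer that is a square modulo four. -/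
theorem coords_of_four_dvd_sub_sq (hirr : Irreducible (X ^ 4 + 2 * X ^ 2 - 1 : ℚ[X])) {θ : 𝓞 K}
    (hθ : θ ^ 4 + 2 * θ ^ 2 - 1 = 0) (hgen : Algebra.adjoin ℚ {(θ : K)} = ⊤)
    (e₀ e₁ e₂ e₃ : ℤ) {y : 𝓞 K}
    (h : 4 ∣ (e₀ + e₁ * θ + e₂ * θ ^ 2 + e₃ * θ ^ 3 : 𝓞 K) - y ^ 2) :
    ∃ a b c d : ZMod 4, e₀ = a ^ 2 + c ^ 2 + 2 * b * d - 2 * d ^ 2 ∧ e₁ = 2 * a * b + 2 * c * d ∧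
      e₂ = b ^ 2 + 2 * a * c - 2 * c ^ 2 + d ^ 2 ∧ e₃ = 2 * a * d + 2 * b * c := by
  obtain ⟨z, hz⟩ := h
  obtain ⟨a, b, c, d, rfl⟩ := exists_coords hirr hθ hgen y
  obtain ⟨p, q, r, s, rfl⟩ := exists_coords hirr hθ hgen z
  obtain ⟨h0, h1, h2, h3⟩ := coords_eq_zero hirr hθ
    (a := e₀ - (a ^ 2 + c ^ 2 + 2 * b * d - 2 * d ^ 2) - 4 * p)
    (b := e₁ - (2 * a * b + 2 * c * d) - 4 * q)
    (c := e₂ - (b ^ 2 + 2 * a * c - 2 * c ^ 2 - 4 * b * d + 5 * d ^ 2) - 4 * r)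
    (d := e₃ - (2 * a * d + 2 * b * c - 4 * c * d) - 4 * s) (by
      push_cast
      linear_combination hz + (2 * b * d + c ^ 2 + 2 * c * d * θ + d ^ 2 * (θ ^ 2 - 2)) * hθ)
  have h4 : (4 : ZMod 4) = 0 := rfl
  refine ⟨a, b, c, d, ?_, ?_, ?_, ?_⟩
  · have := congrArg (Int.cast : ℤ → ZMod 4) h0
    push_cast at this
    linear_combination this + p * h4
  · have := congrArg (Int.cast : ℤ → ZMod 4) h1
    push_cast at this
    linear_combination this + q * h4
  · have := congrArg (Int.cast : ℤ → ZMod 4) h2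
    push_cast at this
    linear_combination this + (r - b * d + d ^ 2) * h4
  · have := congrArg (Int.cast : ℤ → ZMod 4) h3
    push_cast at this
    linear_combination this + (s - c * d) * h4

theorem pow_toNat_xor {G : Type*} [CommGroup G] (hG : ∀ x : G, x ^ 2 = 1) (x y z : G)
    (i j k i' j' k' : Bool) :
    x ^ (i ^^ i').toNat * y ^ (j ^^ j').toNat * z ^ (k ^^ k').toNat =
      x ^ i.toNat * y ^ j.toNat * z ^ k.toNat * (x ^ i'.toNat * y ^ j'.toNat * z ^ k'.toNat) := by
  have h (x : G) (i j : Bool) : x ^ (i ^^ j).toNat = x ^ i.toNat * x ^ j.toNat := by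
    cases i <;> cases j <;> simp [← sq, hG]
  rw [h, h, h]
  ac_rfl

theorem exists_pow_toNat_eq_zpow {G : Type*} [Group G] {x : G} (hx : x ^ 2 = 1) (n : ℤ) :
    ∃ i : Bool, x ^ i.toNat = x ^ n := by
  obtain ⟨k, rfl | rfl⟩ := Int.even_or_odd' n
  · exact ⟨false, by rw [zpow_mul, zpow_ofNat, hx]; simp⟩
  · exact ⟨true, by rw [zpow_add, zpow_mul, zpow_ofNat, hx]; simp⟩

/-- The group of units modulo squares has at most `2 ^ (rank + 1)` elements. -/
theorem card_units_mod_squares_le (K : Type*) [Field K] [NumberField K] :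
    Finite ((𝓞 K)ˣ ⧸ (powMonoidHom 2 : (𝓞 K)ˣ →* (𝓞 K)ˣ).range) ∧
    Nat.card ((𝓞 K)ˣ ⧸ (powMonoidHom 2 : (𝓞 K)ˣ →* (𝓞 K)ˣ).range) ≤
      2 * 2 ^ Units.rank K := by
  obtain ⟨g, hg⟩ := IsCyclic.exists_generator (α := Units.torsion K)
  set H := (powMonoidHom 2 : (𝓞 K)ˣ →* (𝓞 K)ˣ).range
  have hsq (x : (𝓞 K)ˣ) : (x : (𝓞 K)ˣ ⧸ H) ^ 2 = 1 := by
    rw [← QuotientGroup.mk_pow, QuotientGroup.eq_one_iff]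
    exact ⟨x, rfl⟩
  let f : Bool × (Fin (Units.rank K) → Bool) → (𝓞 K)ˣ ⧸ H := fun p =>
    ((g : (𝓞 K)ˣ) : (𝓞 K)ˣ ⧸ H) ^ p.1.toNat *
      ∏ i, ((Units.fundSystem K i : (𝓞 K)ˣ) : (𝓞 K)ˣ ⧸ H) ^ (p.2 i).toNat
  have hf : Function.Surjective f := by
    intro y
    obtain ⟨x, rfl⟩ := QuotientGroup.mk_surjective y
    obtain ⟨⟨ζ, e⟩, hx, -⟩ := Units.exist_unique_eq_mul_prod K x
    obtain ⟨z, hz⟩ := Subgroup.mem_zpowers_iff.1 (hg ζ)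
    obtain ⟨s, hs⟩ := exists_pow_toNat_eq_zpow (hsq g) z
    choose t ht using fun i => exists_pow_toNat_eq_zpow (hsq (Units.fundSystem K i)) (e i)
    refine ⟨(s, t), ?_⟩
    simp only [f, hs, ht]
    rw [hx, ← hz]
    simp only [QuotientGroup.mk_mul, QuotientGroup.mk_prod, QuotientGroup.mk_zpow,
      Subgroup.coe_zpow]
  refine ⟨Finite.of_surjective f hf, (Nat.card_le_card_of_surjective f hf).trans_eq ?_⟩
  simp

/-- A unit of `ℤ[θ]` that is a square modulo four is a square. -/
theorem exists_sq_of_four_dvd_sub_sq (hirr : Irreducible (X ^ 4 + 2 * X ^ 2 - 1 : ℚ[X])) {θ : 𝓞 K}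
    (hθ : θ ^ 4 + 2 * θ ^ 2 - 1 = 0) (hgen : Algebra.adjoin ℚ {(θ : K)} = ⊤) (ε : (𝓞 K)ˣ)
    {y : 𝓞 K} (h : 4 ∣ (ε : 𝓞 K) - y ^ 2) : ∃ η : (𝓞 K)ˣ, ε = η ^ 2 := by
  have hθK : (θ : K) ^ 4 + 2 * (θ : K) ^ 2 - 1 = 0 := by
    simpa [map_ofNat] using congrArg (algebraMap (𝓞 K) K) hθ
  obtain ⟨hfin, hcard⟩ := card_units_mod_squares_le K
  rw [units_rank_eq_two (finrank_eq_four hirr hθK hgen) (discr_eq hirr hθ hgen)] at hcard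
  let t : (𝓞 K)ˣ := ⟨θ, 2 * θ + θ ^ 3, by linear_combination hθ, by linear_combination hθ⟩
  let b : (𝓞 K)ˣ := ⟨1 + θ + θ ^ 3, 5 - 7 * θ + 2 * θ ^ 2 - 3 * θ ^ 3,
    by linear_combination (-4 + 2 * θ - 3 * θ ^ 2) * hθ,
    by linear_combination (-4 + 2 * θ - 3 * θ ^ 2) * hθ⟩
  let Φ : Bool × Bool × Bool → (𝓞 K)ˣ := fun p =>
    (-1) ^ p.1.toNat * t ^ p.2.1.toNat * b ^ p.2.2.toNat
  have hΦ : ∀ p, (∃ y, 4 ∣ (Φ p : 𝓞 K) - y ^ 2) → p = (false, false, false) := by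
    rintro ⟨i, j, k⟩ ⟨y, hy⟩
    by_contra hne
    have key (e₀ e₁ e₂ e₃ : ℤ) (he : (Φ (i, j, k) : 𝓞 K) =
        e₀ + e₁ * θ + e₂ * θ ^ 2 + e₃ * θ ^ 3) :=
      coords_of_four_dvd_sub_sq hirr hθ hgen e₀ e₁ e₂ e₃ (y := y) (by rwa [he] at hy)
    cases i <;> cases j <;> cases k
    · exact hne rfl
    · exact absurd (key 1 1 0 1 (by simp [Φ, b])) (by decide)
    · exact absurd (key 0 1 0 0 (by simp [Φ, t])) (by decide)
    · exact absurd (key 1 1 (-1) 0 (by simp [Φ, t, b]; linear_combination hθ)) (by decide)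
    · exact absurd (key (-1) 0 0 0 (by simp [Φ])) (by decide)
    · exact absurd (key (-1) (-1) 0 (-1) (by simp [Φ, b]; ring)) (by decide)
    · exact absurd (key 0 (-1) 0 0 (by simp [Φ, t])) (by decide)
    · exact absurd (key (-1) (-1) 1 0 (by simp [Φ, t, b]; linear_combination -hθ)) (by decide)
  set H := (powMonoidHom 2 : (𝓞 K)ˣ →* (𝓞 K)ˣ).range
  have hsq (x : (𝓞 K)ˣ) : (x : (𝓞 K)ˣ ⧸ H) ^ 2 = 1 := by
    rw [← QuotientGroup.mk_pow, QuotientGroup.eq_one_iff]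
    exact ⟨x, rfl⟩
  have hmk (p : Bool × Bool × Bool) : (Φ p : (𝓞 K)ˣ ⧸ H) =
      ((-1 : (𝓞 K)ˣ) : (𝓞 K)ˣ ⧸ H) ^ p.1.toNat *
      (t : (𝓞 K)ˣ ⧸ H) ^ p.2.1.toNat * (b : (𝓞 K)ˣ ⧸ H) ^ p.2.2.toNat := by
    simp only [Φ, QuotientGroup.mk_mul, QuotientGroup.mk_pow]
  have hinj : Function.Injective fun p => (Φ p : (𝓞 K)ˣ ⧸ H) := by
    intro p q hpq
    simp only at hpq
    have h1 : (Φ (p.1 ^^ q.1, p.2.1 ^^ q.2.1, p.2.2 ^^ q.2.2) : (𝓞 K)ˣ ⧸ H) = 1 := by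
      calc _ = (Φ p : (𝓞 K)ˣ ⧸ H) * Φ q := by
            rw [hmk, hmk p, hmk q]
            refine pow_toNat_xor (G := (𝓞 K)ˣ ⧸ H) (fun x => ?_) _ _ _ _ _ _ _ _ _
            obtain ⟨x, rfl⟩ := QuotientGroup.mk_surjective x
            exact hsq x
        _ = 1 := by rw [hpq, ← sq, hsq]
    obtain ⟨η, hη⟩ := (QuotientGroup.eq_one_iff _).1 h1
    have h2 := hΦ _ ⟨η, by rw [← hη]; simp⟩
    simp only [Prod.mk.injEq] at h2
    exact Prod.ext (by grind) (Prod.ext (by grind) (by grind))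
  have hbij := hinj.bijective_of_nat_card_le (by simpa using hcard)
  obtain ⟨p, hp⟩ := hbij.2 ε
  obtain ⟨η, hη⟩ := QuotientGroup.eq.1 hp.symm
  have hη' : Φ p = ε * η ^ 2 := by
    rw [show η ^ 2 = ε⁻¹ * Φ p from hη, mul_inv_cancel_left]
  have hp0 : p = (false, false, false) := by
    refine hΦ p ⟨y * η, ?_⟩
    rw [hη']
    push_cast
    convert h.mul_right ((η : 𝓞 K) ^ 2) using 1
    ring
  refine ⟨η⁻¹, ?_⟩
  have h1 : Φ p = 1 := by rw [hp0]; simp [Φ]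
  rw [h1] at hη'
  rw [inv_pow]
  exact eq_inv_of_mul_eq_one_left hη'.symm

end QuarticField

/-- The arithmetic properties of the ring of integers of `ℚ(θ)` used in the descent. -/
structure IsThetaRing {R : Type*} [CommRing R] (θ : R) : Prop where
  root : θ ^ 4 + 2 * θ ^ 2 - 1 = 0
  prime : Prime (θ - 1)
  dvd_or_dvd_sub_one (x : R) : θ - 1 ∣ x ∨ θ - 1 ∣ x - 1
  exists_unit_sq (ε : Rˣ) {y : R} : 4 ∣ (ε : R) - y ^ 2 → ∃ η : Rˣ, ε = η ^ 2

/-- Twice the quartic `s⁴ - (θ + θ²) s² e² + (1 + θ + θ³) e⁴` represents a square with `s` odd and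
`e` exactly divisible by `2 ^ j`. -/
def SquareValue {R : Type*} [CommRing R] (θ : R) (j : ℕ) : Prop :=
  ∃ s d w : R, ¬ θ - 1 ∣ s ∧ ¬ θ - 1 ∣ d ∧
    w ^ 2 = s ^ 4 - (θ + θ ^ 2) * s ^ 2 * (2 ^ j * d) ^ 2 + (1 + θ + θ ^ 3) * (2 ^ j * d) ^ 4

section Domain

variable {R : Type*} [CommRing R] [IsDomain R] [IsPrincipalIdealRing R]

theorem exists_isCoprime_eq_mul (x y : R) :
    ∃ g x' y', x = g * x' ∧ y = g * y' ∧ IsCoprime x' y' := by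
  classical
  let := IsBezout.toGCDDomain R
  obtain ⟨x', y', hx, hy, h⟩ := extract_gcd x y
  exact ⟨_, x', y', hx, hy, (gcd_isUnit_iff _ _).1 h⟩

theorem exists_unit_mul_sq {x y z : R} (hxy : IsCoprime x y) (ε : Rˣ) (h : x * y = ε * z ^ 2) :
    ∃ (μ : Rˣ) (α : R), x = μ * α ^ 2 := by
  obtain ⟨d, u, hu⟩ := exists_associated_pow_of_associated_pow_mul hxy (c := z) (k := 2)
    ⟨ε, by rw [h, mul_comm]⟩
  exact ⟨u, d, by rw [← hu, mul_comm]⟩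

theorem two_dvd_of_sq_add {x s c : R} (h : x ^ 2 + 2 * s * x = 4 * c) : 2 ∣ x := by
  by_cases h2 : (2 : R) = 0
  · have : x ^ 2 = 0 := by linear_combination h + (2 * c - s * x) * h2
    rw [pow_eq_zero_iff two_ne_zero] at this
    simp [this]
  have h2' : (2 : FractionRing R) ≠ 0 := by
    have := (map_ne_zero_iff (algebraMap R (FractionRing R)) (IsFractionRing.injective R _)).2 h2
    rwa [map_ofNat] at this
  have hint : IsIntegral R (algebraMap R (FractionRing R) x / 2) := by
    refine ⟨X ^ 2 + C s * X - C c, by monicity!, ?_⟩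
    have h' := congrArg (algebraMap R (FractionRing R)) h
    simp only [map_add, map_mul, map_pow, map_ofNat] at h'
    simp only [eval₂_sub, eval₂_add, eval₂_mul, eval₂_pow, eval₂_X, eval₂_C]
    field_simp
    linear_combination h'
  obtain ⟨y, hy⟩ := IsIntegrallyClosed.isIntegral_iff.1 hint
  refine ⟨y, IsFractionRing.injective R (FractionRing R) ?_⟩
  rw [map_mul, hy, map_ofNat]
  field_simp

end Domain

namespace IsThetaRing

variable {R : Type*} [CommRing R] {θ : R}

theorem dvd_two (h : IsThetaRing θ) : θ - 1 ∣ 2 := sub_one_dvd_two h.root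

theorem dvd_theta_add_sq (h : IsThetaRing θ) : θ - 1 ∣ θ + θ ^ 2 := by
  have := dvd_add (⟨θ + 2, by ring⟩ : θ - 1 ∣ θ + θ ^ 2 - 2) h.dvd_two
  simpa using this

theorem not_dvd_add (_h : IsThetaRing θ) {x y : R} (hx : ¬ θ - 1 ∣ x) (hy : θ - 1 ∣ y) :
    ¬ θ - 1 ∣ x + y := (dvd_add_left hy).not.2 hx

theorem not_dvd_mul (h : IsThetaRing θ) {x y : R} (hx : ¬ θ - 1 ∣ x) (hy : ¬ θ - 1 ∣ y) :
    ¬ θ - 1 ∣ x * y := by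
  rw [h.prime.dvd_mul]
  tauto

theorem not_dvd_pow (h : IsThetaRing θ) {x : R} (hx : ¬ θ - 1 ∣ x) (n : ℕ) :
    ¬ θ - 1 ∣ x ^ n := fun h' => hx (h.prime.dvd_of_dvd_pow h')

theorem not_dvd_unit (h : IsThetaRing θ) (u : Rˣ) : ¬ θ - 1 ∣ (u : R) :=
  fun h' => h.prime.not_isUnit (isUnit_of_dvd_unit h' u.isUnit)

theorem dvd_add_of_not_dvd (h : IsThetaRing θ) {x y : R} (hx : ¬ θ - 1 ∣ x) (hy : ¬ θ - 1 ∣ y) :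
    θ - 1 ∣ x + y := by
  have h1 := (h.dvd_or_dvd_sub_one x).resolve_left hx
  have h2 := (h.dvd_or_dvd_sub_one y).resolve_left hy
  have := dvd_add (dvd_add h1 h2) h.dvd_two
  ring_nf at this ⊢
  exact this

theorem isUnit_b (h : IsThetaRing θ) : IsUnit (1 + θ + θ ^ 3) :=
  IsUnit.of_mul_eq_one (5 - 7 * θ + 2 * θ ^ 2 - 3 * θ ^ 3)
    (by linear_combination (-4 + 2 * θ - 3 * θ ^ 2) * h.root)

/-- The eighth power of an odd number is one modulo four. -/
theorem four_dvd_pow_eight_sub_one (h : IsThetaRing θ) {x : R} (hx : ¬ θ - 1 ∣ x) :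
    4 ∣ x ^ 8 - 1 := by
  obtain ⟨z, hz⟩ := (h.dvd_or_dvd_sub_one x).resolve_left hx
  obtain ⟨t, ht⟩ := h.dvd_two
  have h2 : ∃ y, x ^ 2 - 1 = (θ - 1) ^ 2 * y :=
    ⟨z * (z + t), by linear_combination (x + 1) * hz + (θ - 1) * z * hz + (θ - 1) * z * ht⟩
  obtain ⟨y, hy⟩ := h2
  have h4 : ∃ w, x ^ 4 - 1 = 2 * w := by
    refine ⟨(1 - 2 * θ + 2 * θ ^ 2 - 2 * θ ^ 3) * y ^ 2 + (θ - 1) ^ 2 * y, ?_⟩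
    linear_combination (x ^ 2 + 1) * hy + (θ - 1) ^ 2 * y * hy + y ^ 2 * h.root
  obtain ⟨w, hw⟩ := h4
  exact ⟨w * (w + 1), by linear_combination (x ^ 4 + 1 + 2 * w) * hw⟩

theorem exists_eq_mul_unit_sq (h : IsThetaRing θ) {μ ν : Rˣ} {x y : R} (hx : ¬ θ - 1 ∣ x)
    (hxy : 4 ∣ μ * x ^ 2 - ν * y ^ 2) : ∃ η : Rˣ, μ = ν * η ^ 2 := by
  obtain ⟨η, hη⟩ := h.exists_unit_sq (μ * ν⁻¹) (y := y * x ^ 3) (by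
    have h1 := (hxy.mul_left ((ν⁻¹ : Rˣ) : R)).mul_right (x ^ 6)
    have h2 := (h.four_dvd_pow_eight_sub_one hx).mul_left (((μ * ν⁻¹ : Rˣ) : R))
    have h3 := dvd_sub h1 h2
    convert h3 using 1
    push_cast
    linear_combination y ^ 2 * x ^ 6 * ν.inv_mul)
  exact ⟨η, by rw [← hη]; simp⟩

theorem two_ne_zero [IsDomain R] (h : IsThetaRing θ) : (2 : R) ≠ 0 := by
  intro h2
  refine pow_ne_zero 4 h.prime.ne_zero ?_
  linear_combination h.root + (1 - 2 * θ + 2 * θ ^ 2 - 2 * θ ^ 3) * h2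

end IsThetaRing

namespace IsThetaRing

variable {R : Type*} [CommRing R] [IsDomain R] [IsPrincipalIdealRing R] {θ : R}

theorem isCoprime_sub_one (h : IsThetaRing θ) {x : R} (hx : ¬ θ - 1 ∣ x) : IsCoprime (θ - 1) x :=
  h.prime.coprime_iff_not_dvd.2 hx

theorem isCoprime_two (h : IsThetaRing θ) {x : R} (hx : ¬ θ - 1 ∣ x) : IsCoprime 2 x :=
  (h.isCoprime_sub_one hx).pow_left (m := 4) |>.of_isCoprime_of_dvd_left
    ⟨1 - 2 * θ + 2 * θ ^ 2 - 2 * θ ^ 3, by linear_combination h.root⟩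

/-- The value of `SquareValue` may be assumed primitive. -/
theorem exists_isCoprime_of_squareValue {j : ℕ} (hj : SquareValue θ j) :
    ∃ s d w : R, ¬ θ - 1 ∣ s ∧ ¬ θ - 1 ∣ d ∧ IsCoprime s d ∧
    w ^ 2 = s ^ 4 - (θ + θ ^ 2) * s ^ 2 * (2 ^ j * d) ^ 2 +
      (1 + θ + θ ^ 3) * (2 ^ j * d) ^ 4 := by
  obtain ⟨s, d, w, hs, hd, hw⟩ := hj
  obtain ⟨g, s, d, rfl, rfl, hsd⟩ := exists_isCoprime_eq_mul s d
  have hs' : ¬ θ - 1 ∣ s := fun h' => hs (h'.mul_left g)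
  have hd' : ¬ θ - 1 ∣ d := fun h' => hd (h'.mul_left g)
  have hg : g ≠ 0 := by rintro rfl; simp at hs
  have hgw : g ^ 2 ∣ w := by
    rw [← IsIntegrallyClosed.pow_dvd_pow_iff (n := 2) (by norm_num), hw]
    exact ⟨s ^ 4 - (θ + θ ^ 2) * s ^ 2 * (2 ^ j * d) ^ 2 +
      (1 + θ + θ ^ 3) * (2 ^ j * d) ^ 4, by ring⟩
  obtain ⟨w, rfl⟩ := hgw
  refine ⟨s, d, w, hs', hd', hsd, mul_left_cancel₀ (pow_ne_zero 4 hg) ?_⟩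
  linear_combination hw

/-- First half of the descent: a solution with `e` replaced by `2 * e` comes from the isogenous
quartic. -/
theorem exists_sq_eq_of_sq_eq (h : IsThetaRing θ) {s e w : R} (hs : ¬ θ - 1 ∣ s)
    (hse : IsCoprime s e)
    (hw : w ^ 2 = s ^ 4 - (θ + θ ^ 2) * s ^ 2 * (2 * e) ^ 2 + (1 + θ + θ ^ 3) * (2 * e) ^ 4) :
    ∃ r q : R, ¬ θ - 1 ∣ r ∧ IsCoprime r q ∧ r * q = e ^ 2 ∧
      s ^ 2 = (r + (θ + θ ^ 2) * q) ^ 2 - 4 * (1 + θ + θ ^ 3) * q ^ 2 := by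
  have h2 := h.two_ne_zero
  have ha := h.dvd_theta_add_sq
  have hk : ∃ k, θ - 1 ∣ k ∧
      k * (k + s ^ 2) = e ^ 2 * (4 * (1 + θ + θ ^ 3) * e ^ 2 - (θ + θ ^ 2) * s ^ 2) := by
    obtain ⟨k, hk⟩ := two_dvd_of_sq_add (x := w - s ^ 2) (s := s ^ 2)
      (c := e ^ 2 * (4 * (1 + θ + θ ^ 3) * e ^ 2 - (θ + θ ^ 2) * s ^ 2))
      (by linear_combination hw)
    have hk2 : k * (k + s ^ 2) =
        e ^ 2 * (4 * (1 + θ + θ ^ 3) * e ^ 2 - (θ + θ ^ 2) * s ^ 2) := by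
      apply mul_left_cancel₀ (mul_ne_zero h2 h2)
      linear_combination hw - (w + s ^ 2 + 2 * k) * hk
    have hdvd : θ - 1 ∣ k * (k + s ^ 2) := by
      rw [hk2]
      refine Dvd.dvd.mul_left (dvd_sub ?_ (ha.mul_right _)) _
      exact (h.dvd_two.mul_right (2 * (1 + θ + θ ^ 3) * e ^ 2)).trans (dvd_of_eq (by ring))
    obtain hd | hd := h.prime.dvd_or_dvd hdvd
    · exact ⟨k, hd, hk2⟩
    · exact ⟨-k - s ^ 2, by rw [← neg_add', dvd_neg]; exact hd, by linear_combination hk2⟩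
  obtain ⟨k, hkd, hk⟩ := hk
  set g₁ := s ^ 2 + k - (θ + θ ^ 2) * e ^ 2 with hg₁
  set g₂ := -(θ + θ ^ 2) * e ^ 2 - k with hg₂
  let v : Rˣ := ⟨-22 - 34 * θ - 9 * θ ^ 2 - 14 * θ ^ 3, -4 + 6 * θ - θ ^ 2 + 2 * θ ^ 3,
    by linear_combination (-87 - 4 * θ - 28 * θ ^ 2) * h.root,
    by linear_combination (-87 - 4 * θ - 28 * θ ^ 2) * h.root⟩
  have hv : (θ - 1) ^ 2 * (v : R) = (θ + θ ^ 2) ^ 2 - 4 * (1 + θ + θ ^ 3) := by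
    linear_combination (18 - 14 * θ) * h.root
  have hg : g₁ * g₂ = (θ - 1) ^ 2 * v * e ^ 4 := by
    rw [hv]
    linear_combination - hk
  have hodd : ¬ θ - 1 ∣ g₁ := fun h' =>
    h.not_dvd_add (h.not_dvd_add (h.not_dvd_pow hs 2) hkd) ((ha.mul_right (e ^ 2)).neg_right)
      (h'.trans (dvd_of_eq (by rw [hg₁]; ring)))
  have hcop : IsCoprime g₁ g₂ := by
    refine isCoprime_of_prime_dvd (fun h' => hodd (by simp [h'.1])) fun z hz h₁ h₂ => ?_
    have hzg := h₁.mul_right g₂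
    rw [hg] at hzg
    obtain hz' | hz' := hz.dvd_or_dvd hzg
    · obtain hz' | hz' := hz.dvd_or_dvd hz'
      · exact hodd (((hz.associated_of_dvd h.prime (hz.dvd_of_dvd_pow hz')).dvd_iff_dvd_left).1 h₁)
      · exact hz.not_isUnit (isUnit_of_dvd_unit hz' v.isUnit)
    · have hze := hz.dvd_of_dvd_pow hz'
      have hzs : z ∣ s ^ 2 := by
        have := dvd_add (dvd_add h₁ h₂) (hze.mul_right (2 * (θ + θ ^ 2) * e))
        convert this using 1
        rw [hg₁, hg₂]
        ring
      exact hz.not_isUnit (hse.isUnit_of_dvd' (hz.dvd_of_dvd_pow hzs) hze)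
  obtain ⟨g₃, hg₃⟩ : (θ - 1) ^ 2 ∣ g₂ :=
    (h.isCoprime_sub_one hodd).pow_left.dvd_of_dvd_mul_left (y := g₁)
      ⟨v * e ^ 4, by rw [hg, mul_assoc]⟩
  have hg13 : g₁ * g₃ = v * (e ^ 2) ^ 2 := by
    apply mul_left_cancel₀ (pow_ne_zero 2 h.prime.ne_zero)
    linear_combination hg - g₁ * hg₃
  obtain ⟨μ, x, hx⟩ := exists_unit_mul_sq
    (hcop.of_isCoprime_of_dvd_right (hg₃ ▸ dvd_mul_left g₃ _)) v hg13
  have hxodd : ¬ θ - 1 ∣ x := fun h' => hodd (hx ▸ (h'.pow (by norm_num)).mul_left _)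
  obtain ⟨η, hη⟩ := h.exists_eq_mul_unit_sq (μ := μ) (ν := 1) (h.not_dvd_mul hs hxodd)
    (y := s ^ 2 + k) ⟨-(1 + θ + θ ^ 3) * e ^ 4, by
      push_cast
      linear_combination - s ^ 2 * hx + s ^ 2 * hg₁ - hk⟩
  rw [one_mul] at hη
  set r := η * x with hr
  have hgr : g₁ = r ^ 2 := by
    rw [hx, hη, hr]
    push_cast
    ring
  have hrodd : ¬ θ - 1 ∣ r := h.not_dvd_mul (h.not_dvd_unit η) hxodd
  have hr0 : r ≠ 0 := by rintro h0; simp [h0] at hrodd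
  obtain ⟨q, hq⟩ : r ∣ e ^ 2 := by
    rw [← IsIntegrallyClosed.pow_dvd_pow_iff (n := 2) (by norm_num)]
    exact ⟨g₃ * (v⁻¹ : Rˣ), by
      linear_combination ((v⁻¹ : Rˣ) : R) * g₃ * hgr - ((v⁻¹ : Rˣ) : R) * hg13 - e ^ 4 * v.inv_mul⟩
  have hq3 : g₃ = v * q ^ 2 := by
    apply mul_left_cancel₀ (pow_ne_zero 2 hr0)
    linear_combination - g₃ * hgr + hg13 + v * (e ^ 2 + r * q) * hq
  refine ⟨r, q, hrodd, ?_, hq.symm, ?_⟩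
  · refine (hcop.of_isCoprime_of_dvd_left ?_).of_isCoprime_of_dvd_right ?_
    · exact hgr ▸ dvd_pow_self r (by norm_num)
    · rw [hg₃, hq3]
      exact ((dvd_pow_self q (by norm_num)).mul_left _).mul_left _
  · linear_combination hgr - hg₁ - hg₂ + hg₃ + (θ - 1) ^ 2 * hq3 + q ^ 2 * hv +
      2 * (θ + θ ^ 2) * hq

end IsThetaRing

namespace IsThetaRing

variable {R : Type*} [CommRing R] [IsDomain R] [IsPrincipalIdealRing R] {θ : R}

/-- Second half of the descent. -/
theorem squareValue_of_sq_eq (h : IsThetaRing θ) {r q s d : R} {j : ℕ} (hr : ¬ θ - 1 ∣ r)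
    (hd : ¬ θ - 1 ∣ d) (hrq : IsCoprime r q) (hmul : r * q = (2 ^ j * d) ^ 2)
    (hs : s ^ 2 = (r + (θ + θ ^ 2) * q) ^ 2 - 4 * (1 + θ + θ ^ 3) * q ^ 2) :
    1 ≤ j ∧ SquareValue θ j := by
  have h2 := h.two_ne_zero
  have ha := h.dvd_theta_add_sq
  obtain ⟨b, hb⟩ := h.isUnit_b
  have hodd : ¬ θ - 1 ∣ r + (θ + θ ^ 2) * q := h.not_dvd_add hr (ha.mul_right q)
  obtain ⟨p, p', hadd, hpp, hp⟩ : ∃ p p', p + p' = r + (θ + θ ^ 2) * q ∧ p * p' = b * q ^ 2 ∧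
      ¬ θ - 1 ∣ p := by
    obtain ⟨p, hp⟩ := two_dvd_of_sq_add (x := r + (θ + θ ^ 2) * q + s) (s := -s)
      (c := (1 + θ + θ ^ 3) * q ^ 2) (by linear_combination -hs)
    have hpp : p * (r + (θ + θ ^ 2) * q - p) = b * q ^ 2 := by
      apply mul_left_cancel₀ (mul_ne_zero h2 h2)
      linear_combination -hs - 4 * q ^ 2 * hb - (r + (θ + θ ^ 2) * q - s - 2 * p) * hp
    by_cases hp1 : θ - 1 ∣ p
    · refine ⟨r + (θ + θ ^ 2) * q - p, p, by ring, by rw [mul_comm, hpp], fun hp2 => hodd ?_⟩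
      exact (dvd_add hp1 hp2).trans (dvd_of_eq (by ring))
    · exact ⟨p, r + (θ + θ ^ 2) * q - p, by ring, hpp, hp1⟩
  have hcop : IsCoprime p p' := by
    refine isCoprime_of_prime_dvd (fun h' => hp (by simp [h'.1])) fun z hz h₁ h₂ => ?_
    have hzq := h₁.mul_right p'
    rw [hpp] at hzq
    obtain hz' | hz' := hz.dvd_or_dvd hzq
    · exact hz.not_isUnit (isUnit_of_dvd_unit hz' b.isUnit)
    · have hzq := hz.dvd_of_dvd_pow hz'
      have hzr : z ∣ r := (dvd_sub (dvd_add h₁ h₂) (hzq.mul_left (θ + θ ^ 2))).trans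
        (dvd_of_eq (by linear_combination hadd))
      exact hz.not_isUnit (hrq.isUnit_of_dvd' hzr hzq)
  have hp' : θ - 1 ∣ p' := by
    have := h.dvd_add_of_not_dvd hodd (y := -p) (by rwa [dvd_neg])
    exact this.trans (dvd_of_eq (by linear_combination -hadd))
  have hq : θ - 1 ∣ q := by
    have hq' := hp'.mul_left p
    rw [hpp] at hq'
    exact h.prime.dvd_of_dvd_pow ((h.prime.dvd_or_dvd hq').resolve_left (h.not_dvd_unit b))
  have hj : j ≠ 0 := by
    rintro rfl
    refine h.not_dvd_pow hd 2 ?_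
    have := hq.mul_left r
    rwa [hmul, pow_zero, one_mul] at this
  refine ⟨Nat.one_le_iff_ne_zero.2 hj, ?_⟩
  have h4 : (4 : R) ∣ (2 ^ j) ^ 2 := by
    obtain ⟨i, rfl⟩ := Nat.exists_eq_succ_of_ne_zero hj
    exact ⟨(2 ^ i) ^ 2, by rw [Nat.succ_eq_add_one, pow_succ]; ring⟩
  have hT0 : (2 ^ j : R) ≠ 0 := pow_ne_zero j h2
  obtain ⟨q₀, rfl⟩ : (2 ^ j) ^ 2 ∣ q :=
    ((h.isCoprime_two hr).pow_left.pow_left).dvd_of_dvd_mul_left (y := r)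
      ⟨d ^ 2, by rw [hmul, mul_pow]⟩
  obtain ⟨p₀, rfl⟩ : (2 ^ j) ^ 4 ∣ p' :=
    ((h.isCoprime_two hp).pow_left.pow_left).dvd_of_dvd_mul_left (y := p)
      ⟨b * q₀ ^ 2, by rw [hpp]; ring⟩
  have hrq₀ : r * q₀ = d ^ 2 := by
    apply mul_left_cancel₀ (pow_ne_zero 2 hT0)
    linear_combination hmul
  have hpp₀ : p * p₀ = b * q₀ ^ 2 := by
    apply mul_left_cancel₀ (pow_ne_zero 4 hT0)
    linear_combination hpp
  have hq₀ : ¬ θ - 1 ∣ q₀ := fun h' => h.not_dvd_pow hd 2 (hrq₀ ▸ h'.mul_left r)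
  have hcop₀ : IsCoprime r q₀ := hrq.of_isCoprime_of_dvd_right (dvd_mul_left q₀ _)
  obtain ⟨μ, α, hα⟩ := exists_unit_mul_sq
    (hcop.of_isCoprime_of_dvd_right (dvd_mul_left p₀ _)) b hpp₀
  obtain ⟨ε, f, hf⟩ := exists_unit_mul_sq hcop₀ 1 (by rw [hrq₀, Units.val_one, one_mul])
  obtain ⟨ε', g, hg⟩ := exists_unit_mul_sq hcop₀.symm 1
    (by rw [mul_comm, hrq₀, Units.val_one, one_mul])
  have hαodd : ¬ θ - 1 ∣ α := fun h' => hp (hα ▸ (h'.pow (by norm_num)).mul_left _)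
  have hfodd : ¬ θ - 1 ∣ f := fun h' => hr (hf ▸ (h'.pow (by norm_num)).mul_left _)
  have hgodd : ¬ θ - 1 ∣ g := fun h' => hq₀ (hg ▸ (h'.pow (by norm_num)).mul_left _)
  have hpr : p * r = p ^ 2 - (θ + θ ^ 2) * p * ((2 ^ j) ^ 2 * q₀) + b * ((2 ^ j) ^ 2 * q₀) ^ 2 := by
    linear_combination hpp - p * hadd
  obtain ⟨η, hη⟩ := h.exists_eq_mul_unit_sq (μ := μ * ε) (ν := 1) (h.not_dvd_mul hαodd hfodd)
    (y := p) (by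
      refine (h4.mul_right (q₀ * (b * ((2 ^ j) ^ 2 * q₀) - (θ + θ ^ 2) * p))).trans (dvd_of_eq ?_)
      push_cast
      linear_combination -hpr + p * hf + ε * f ^ 2 * hα)
  obtain ⟨η', hη'⟩ := h.exists_eq_mul_unit_sq (μ := ε * ε') (ν := 1) (h.not_dvd_mul hfodd hgodd)
    (y := d) ⟨0, by
      push_cast
      linear_combination hrq₀ - q₀ * hf - ε * f ^ 2 * hg⟩
  rw [one_mul] at hη hη'
  have hν : ε' = μ * (η * η' * (ε * μ)⁻¹) ^ 2 := by
    have : ε' = μ * (η ^ 2 * η' ^ 2 * ((ε * μ)⁻¹) ^ 2) := by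
      rw [← hη, ← hη', mul_comm ε μ, inv_pow, sq (μ * ε), mul_inv]
      calc ε' = (μ * ε) * (μ * ε)⁻¹ * (ε * ε') * ((ε * μ)⁻¹ * μ) := by
            rw [mul_inv_cancel, one_mul, mul_inv_rev ε, mul_comm ε ε', mul_assoc ε', mul_comm ε]
            simp
        _ = _ := by rw [mul_comm ε μ]; ac_rfl
    rw [this, mul_pow, mul_pow]
  set ν := η * η' * (ε * μ)⁻¹
  have hη2 : (μ * ε : R) = η ^ 2 := by exact_mod_cast congrArg Units.val hη
  have hν2 : (ε' : R) = μ * ν ^ 2 := by exact_mod_cast congrArg Units.val hν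
  refine ⟨α, ν * g, α * f * η * (μ⁻¹ : Rˣ), hαodd, h.not_dvd_mul (h.not_dvd_unit ν) hgodd, ?_⟩
  apply mul_left_cancel₀ (pow_ne_zero 2 μ.ne_zero)
  have hq2 : q₀ = μ * (ν * g) ^ 2 := by rw [hg, hν2]; ring
  rw [← hb]
  calc (μ : R) ^ 2 * (α * f * η * (μ⁻¹ : Rˣ)) ^ 2
      = (μ * (μ⁻¹ : Rˣ)) ^ 2 * (α ^ 2 * f ^ 2 * η ^ 2) := by ring
    _ = p * r := by rw [Units.mul_inv, ← hη2, hα, hf]; ring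
    _ = _ := by rw [hpr, hq2, hα]; ring

/-- The quartic takes no odd square value at an even argument. -/
theorem not_squareValue (h : IsThetaRing θ) {j : ℕ} (hj : 1 ≤ j) : ¬ SquareValue θ j := by
  induction j with
  | zero => omega
  | succ n ih =>
    intro hn
    obtain ⟨s, d, w, hs, hd, hsd, hw⟩ := exists_isCoprime_of_squareValue hn
    have hse : IsCoprime s (2 ^ n * d) := (h.isCoprime_two hs).symm.pow_right.mul_right hsd
    obtain ⟨r, q, hr, hrq, hmul, hs2⟩ := h.exists_sq_eq_of_sq_eq (w := w) hs hse
      (by rw [hw, pow_succ]; ring)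
    obtain ⟨hn1, hn2⟩ := h.squareValue_of_sq_eq hr hd hrq hmul hs2
    exact ih hn1 hn2

theorem squareValue_of_mul_eq_sq (h : IsThetaRing θ) {A B Z : R} {i : ℕ} (hi : 1 ≤ i)
    (hA : ¬ θ - 1 ∣ A) (hB : ¬ θ - 1 ∣ B)
    (hZ : Z ^ 2 = A * B * (A ^ 2 - (θ + θ ^ 2) * A * (4 ^ i * B) +
      (1 + θ + θ ^ 3) * (4 ^ i * B) ^ 2)) : SquareValue θ i := by
  obtain ⟨g, A, B, rfl, rfl, hAB⟩ := exists_isCoprime_eq_mul A B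
  have hA' : ¬ θ - 1 ∣ A := fun h' => hA (h'.mul_left g)
  have hB' : ¬ θ - 1 ∣ B := fun h' => hB (h'.mul_left g)
  have hg : g ≠ 0 := by rintro rfl; simp at hA
  have h2 := h.two_ne_zero
  obtain ⟨b, hb⟩ := h.isUnit_b
  rw [← hb] at hZ
  set C := A ^ 2 - (θ + θ ^ 2) * A * (4 ^ i * B) + b * (4 ^ i * B) ^ 2 with hC
  obtain ⟨Z, rfl⟩ : g ^ 2 ∣ Z := by
    rw [← IsIntegrallyClosed.pow_dvd_pow_iff (n := 2) (by norm_num), hZ]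
    exact ⟨A * B * C, by rw [hC]; ring⟩
  have hZ' : Z ^ 2 = A * B * C := by
    apply mul_left_cancel₀ (pow_ne_zero 4 hg)
    linear_combination hZ
  have h4A : IsCoprime A (4 ^ i * B) := by
    refine IsCoprime.mul_right (IsCoprime.pow_right ?_) hAB
    have := (h.isCoprime_two hA').symm.pow_right (n := 2)
    norm_num at this
    exact this
  have hAC : IsCoprime A C := by
    have h1 : IsCoprime A (b * (4 ^ i * B) ^ 2) :=
      (isCoprime_mul_unit_left_right b.isUnit _ _).2 h4A.pow_right
    have := h1.add_mul_left_right (A - (θ + θ ^ 2) * (4 ^ i * B))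
    convert this using 1
    rw [hC]
    ring
  have hBC : IsCoprime B C := by
    have h1 : IsCoprime B (A ^ 2) := hAB.symm.pow_right
    have := h1.add_mul_left_right (4 ^ i * (b * (4 ^ i * B) - (θ + θ ^ 2) * A))
    convert this using 1
    rw [hC]
    ring
  obtain ⟨μ, s, hs⟩ := exists_unit_mul_sq (hAB.mul_right hAC) 1 (z := Z)
    (by rw [Units.val_one, one_mul, hZ', mul_assoc])
  obtain ⟨μ', d, hd⟩ := exists_unit_mul_sq (hAB.symm.mul_right hBC) 1 (z := Z)
    (by rw [Units.val_one, one_mul, hZ']; ring)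
  obtain ⟨κ, t, ht⟩ := exists_unit_mul_sq (hAC.symm.mul_right hBC.symm) 1 (z := Z)
    (by rw [Units.val_one, one_mul, hZ']; ring)
  have hsodd : ¬ θ - 1 ∣ s := fun h' => hA' (hs ▸ (h'.pow (by norm_num)).mul_left _)
  have hdodd : ¬ θ - 1 ∣ d := fun h' => hB' (hd ▸ (h'.pow (by norm_num)).mul_left _)
  have h4 : (4 : R) ∣ 4 ^ i := dvd_pow_self 4 (by omega)
  have h4C : (4 : R) ∣ C - A ^ 2 :=
    (h4.mul_right (B * (b * (4 ^ i * B) - (θ + θ ^ 2) * A))).trans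
      (dvd_of_eq (by rw [hC]; ring))
  have hCodd : ¬ θ - 1 ∣ C := by
    have h4' : θ - 1 ∣ 4 := (h.dvd_two.mul_right 2).trans (dvd_of_eq (by norm_num))
    have := h.not_dvd_add (h.not_dvd_pow hA' 2) (h4'.trans h4C)
    rwa [add_sub_cancel] at this
  have htodd : ¬ θ - 1 ∣ t := fun h' => hCodd (ht ▸ (h'.pow (by norm_num)).mul_left _)
  obtain ⟨η, hη⟩ := h.exists_eq_mul_unit_sq (μ := κ) (ν := 1) htodd (y := A)
    (by rwa [← ht, Units.val_one, one_mul])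
  obtain ⟨ζ, hζ⟩ := h.exists_eq_mul_unit_sq (μ := μ * μ') (ν := 1)
    (h.not_dvd_mul (h.not_dvd_mul hsodd hdodd) (h.not_dvd_mul (h.not_dvd_unit η) htodd)) (y := Z)
    ⟨0, by
      rw [hZ', hs, hd, ht, hη]
      push_cast
      ring⟩
  rw [one_mul] at hη hζ
  have hη2 : (κ : R) = η ^ 2 := by exact_mod_cast congrArg Units.val hη
  have hζ2 : (μ * μ' : R) = ζ ^ 2 := by exact_mod_cast congrArg Units.val hζ
  refine ⟨s, (ζ * μ⁻¹ : Rˣ) * d, η * (μ⁻¹ : Rˣ) * t, hsodd,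
    h.not_dvd_mul (h.not_dvd_unit _) hdodd, ?_⟩
  have hBμ : B = μ * ((ζ * μ⁻¹ : Rˣ) * d) ^ 2 := by
    push_cast
    linear_combination hd - (μ' : R) * d ^ 2 * (μ * (μ⁻¹ : Rˣ) + 1) * μ.mul_inv +
      μ * d ^ 2 * ((μ⁻¹ : Rˣ) : R) ^ 2 * hζ2
  have h24 : (4 : R) ^ i = (2 ^ i) ^ 2 := by
    rw [← pow_mul, mul_comm, pow_mul]
    norm_num
  apply mul_left_cancel₀ (pow_ne_zero 2 μ.ne_zero)
  rw [← hb]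
  calc (μ : R) ^ 2 * (η * (μ⁻¹ : Rˣ) * t) ^ 2
      = (μ * (μ⁻¹ : Rˣ)) ^ 2 * (η ^ 2 * t ^ 2) := by ring
    _ = C := by rw [Units.mul_inv, ← hη2, ht]; ring
    _ = _ := by rw [hC, hBμ, hs, h24]; ring

end IsThetaRing

theorem exists_eq_two_pow_mul_odd {m : ℤ} (hm : m ≠ 0) :
    ∃ (k : ℕ) (m' : ℤ), m = 2 ^ k * m' ∧ Odd m' := by
  obtain ⟨m', hm', h2⟩ :=
    (Int.finiteMultiplicity_iff.2 ⟨by norm_num, hm⟩ :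
      FiniteMultiplicity 2 m).exists_eq_pow_mul_and_not_dvd
  exact ⟨_, m', hm', by rwa [← Int.not_even_iff_odd, even_iff_two_dvd]⟩

namespace IsThetaRing

variable {R : Type*} [CommRing R] {θ : R}

theorem not_dvd_intCast (h : IsThetaRing θ) {n : ℤ} (hn : Odd n) : ¬ θ - 1 ∣ (n : R) := by
  obtain ⟨k, rfl⟩ := hn
  rw [add_comm]
  push_cast
  exact h.not_dvd_add (fun h1 => h.prime.not_isUnit (isUnit_of_dvd_one h1)) (h.dvd_two.mul_right _)

theorem four_eq (h : IsThetaRing θ) :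
    4 = (θ - 1) ^ 8 * (53 + 82 * θ + 22 * θ ^ 2 + 34 * θ ^ 3) ^ 2 := by
  linear_combination (2 + (θ - 1) ^ 4 * (53 + 82 * θ + 22 * θ ^ 2 + 34 * θ ^ 3)) *
    two_eq_sub_one_pow_four h.root

theorem isUnit_w (h : IsThetaRing θ) : IsUnit (53 + 82 * θ + 22 * θ ^ 2 + 34 * θ ^ 3) :=
  IsUnit.of_mul_eq_one (1 - 2 * θ + 2 * θ ^ 2 - 2 * θ ^ 3)
    (by linear_combination (-52 + 24 * θ - 68 * θ ^ 2) * h.root)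

theorem slope_eq (h : IsThetaRing θ) :
    3 - 3 * θ + θ ^ 2 - θ ^ 3 = (θ - 1) ^ 3 * (-12 - 17 * θ - 5 * θ ^ 2 - 7 * θ ^ 3) := by
  linear_combination (9 - 16 * θ + 7 * θ ^ 2) * h.root

theorem isUnit_v (h : IsThetaRing θ) : IsUnit (-12 - 17 * θ - 5 * θ ^ 2 - 7 * θ ^ 3) :=
  IsUnit.of_mul_eq_one (θ - θ ^ 2 - θ ^ 3) (by linear_combination (1 + 12 * θ + 7 * θ ^ 2) * h.root)

theorem not_dvd_of_isUnit (h : IsThetaRing θ) {u : R} (hu : IsUnit u) : ¬ θ - 1 ∣ u :=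
  fun h' => h.prime.not_isUnit (isUnit_of_dvd_unit h' hu)

theorem exists_intCast_eq (h : IsThetaRing θ) {m : ℤ} (hm : m ≠ 0) :
    ∃ (k : ℕ) (O : R), ¬ θ - 1 ∣ O ∧ (m : R) = (θ - 1) ^ (4 * k) * O := by
  obtain ⟨k, m', rfl, hm'⟩ := exists_eq_two_pow_mul_odd hm
  refine ⟨k, _, h.not_dvd_mul (h.not_dvd_pow (h.not_dvd_of_isUnit h.isUnit_w) k)
    (h.not_dvd_intCast hm'), ?_⟩
  push_cast
  conv_lhs => rw [two_eq_sub_one_pow_four h.root]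
  rw [mul_pow, pow_mul]
  ring

variable [IsDomain R]

theorem eq_pow_mul_of_sq_eq (h : IsThetaRing θ) {O : R} (hO : ¬ θ - 1 ∣ O) {N : ℕ} :
    ∀ {Z : R}, Z ^ 2 = (θ - 1) ^ N * O → ∃ (k : ℕ) (Z' : R), N = 2 * k ∧
      Z = (θ - 1) ^ k * Z' ∧ Z' ^ 2 = O := by
  induction N using Nat.strong_induction_on with
  | _ N ih =>
    intro Z hZ
    match N, ih, hZ with
    | 0, _, hZ => exact ⟨0, Z, rfl, by simp, by simpa using hZ⟩
    | 1, _, hZ =>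
      obtain ⟨Z', rfl⟩ : θ - 1 ∣ Z := h.prime.dvd_of_dvd_pow (Dvd.intro O (by rw [hZ, pow_one]))
      refine absurd ⟨Z' ^ 2, mul_left_cancel₀ h.prime.ne_zero ?_⟩ hO
      linear_combination -hZ
    | N + 2, ih, hZ =>
      obtain ⟨Z', rfl⟩ : θ - 1 ∣ Z :=
        h.prime.dvd_of_dvd_pow (((dvd_pow_self _ (by omega)).mul_right O).trans hZ.symm.dvd)
      obtain ⟨k, Z'', rfl, rfl, h2⟩ := ih N (by omega) (Z := Z')
        (mul_left_cancel₀ (pow_ne_zero 2 h.prime.ne_zero) (by linear_combination hZ))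
      exact ⟨k + 1, Z'', by ring, by ring, h2⟩

theorem exists_eq_pow_mul_of_sub_eq (h : IsThetaRing θ) {O : R} (hO : ¬ θ - 1 ∣ O) {N : ℕ} :
    ∀ {x y : R}, x - y = (θ - 1) ^ N * O → (θ - 1) ^ (2 * N + 1) ∣ x * y →
      (∃ x', ¬ θ - 1 ∣ x' ∧ x = (θ - 1) ^ N * x') ∨ ∃ y', ¬ θ - 1 ∣ y' ∧ y = (θ - 1) ^ N * y' := by
  induction N with
  | zero =>
    intro x y hxy hd
    simp only [pow_zero, one_mul, exists_eq_right'] at hxy ⊢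
    by_contra! hcon
    exact hO (hxy ▸ dvd_sub hcon.1 hcon.2)
  | succ N ih =>
    intro x y hxy hd
    have hsub : θ - 1 ∣ x - y := hxy ▸ (dvd_pow_self _ (by omega)).mul_right O
    have hboth : θ - 1 ∣ x ∧ θ - 1 ∣ y := by
      rcases h.prime.dvd_or_dvd ((dvd_pow_self _ (by omega)).trans hd) with h1 | h1
      · exact ⟨h1, (dvd_sub_right h1).1 hsub⟩
      · exact ⟨(dvd_sub_left h1).1 hsub, h1⟩
    obtain ⟨⟨x, rfl⟩, y, rfl⟩ := hboth
    have h1 : x - y = (θ - 1) ^ N * O :=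
      mul_left_cancel₀ h.prime.ne_zero (by linear_combination hxy)
    have h2 : (θ - 1) ^ (2 * N + 1) ∣ x * y := by
      obtain ⟨z, hz⟩ := hd
      exact ⟨z, mul_left_cancel₀ (pow_ne_zero 2 h.prime.ne_zero) (by linear_combination hz)⟩
    rcases ih h1 h2 with ⟨x', hx, rfl⟩ | ⟨y', hy, rfl⟩
    · exact .inl ⟨x', hx, by ring⟩
    · exact .inr ⟨y', hy, by ring⟩

/-- A point of the curve whose image under the slope map is the rational number `n / m` has odd
`n` and `m`, and its `Y`-coordinate is exactly divisible by `(θ - 1) ^ 3` after clearing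
denominators. -/
theorem odd_of_sq_eq (h : IsThetaRing θ) {n m : ℤ} (hnm : IsCoprime n m) (hm : m ≠ 0) {c Z : R}
    (hc : c = 3 - 3 * θ + θ ^ 2 - θ ^ 3)
    (hZ : Z ^ 2 = c * m * (n + m * θ) * ((n + m * θ) ^ 2 - (θ + θ ^ 2) * c * m * (n + m * θ) +
      (1 + θ + θ ^ 3) * c ^ 2 * m ^ 2)) :
    Odd m ∧ ∃ (k : ℤ) (ν Z' : R), n = 2 * k - m ∧ ν = m + k * (-3 - 3 * θ - θ ^ 2 - θ ^ 3) ∧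
      ¬ θ - 1 ∣ ν ∧ ¬ θ - 1 ∣ Z' ∧ Z = (θ - 1) ^ 3 * Z' ∧
      Z' ^ 2 = (-12 - 17 * θ - 5 * θ ^ 2 - 7 * θ ^ 3) * m * ν *
        (ν ^ 2 - (-1 - 3 * θ - θ ^ 2 - θ ^ 3) * m * ν +
          (10 + 14 * θ + 4 * θ ^ 2 + 6 * θ ^ 3) * m ^ 2) := by
  set v : R := -12 - 17 * θ - 5 * θ ^ 2 - 7 * θ ^ 3 with hv
  have hv' : ¬ θ - 1 ∣ v := h.not_dvd_of_isUnit h.isUnit_v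
  have ht1 : (-1 - 3 * θ - θ ^ 2 - θ ^ 3 : R) = (θ + θ ^ 2) * (θ - 1) ^ 2 * v := by
    rw [hv]
    linear_combination (1 - 9 * θ - 2 * θ ^ 2 + 7 * θ ^ 3) * h.root
  have ht2 : (10 + 14 * θ + 4 * θ ^ 2 + 6 * θ ^ 3 : R) = (1 + θ + θ ^ 3) * (θ - 1) ^ 4 * v ^ 2 := by
    rw [hv]
    linear_combination (134 - 38 * θ - 263 * θ ^ 2 + 277 * θ ^ 3 - 109 * θ ^ 4 - 148 * θ ^ 5 +
      315 * θ ^ 6 - 228 * θ ^ 7 + 126 * θ ^ 8 - 49 * θ ^ 9) * h.root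
  replace hc : c = (θ - 1) ^ 3 * v := hc.trans h.slope_eq
  rcases Int.even_or_odd (n + m) with hs | hs
  · have hm' : Odd m := by
      by_contra hm'
      rw [Int.not_odd_iff_even] at hm'
      have hn' : Even n := (Int.even_add.1 hs).2 hm'
      have := hnm.isUnit_of_dvd' hn'.two_dvd hm'.two_dvd
      norm_num [Int.isUnit_iff] at this
    refine ⟨hm', ?_⟩
    obtain ⟨k, hk⟩ := hs.exists_two_nsmul
    obtain rfl : n = 2 * k - m := by simp at hk; omega
    have hmR := h.not_dvd_intCast hm'
    set ν : R := m + k * (-3 - 3 * θ - θ ^ 2 - θ ^ 3) with hν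
    have ht : (-3 - 3 * θ - θ ^ 2 - θ ^ 3 : R) =
        (θ - 1) * ((θ - 1) ^ 2 * (53 + 82 * θ + 22 * θ ^ 2 + 34 * θ ^ 3)) := by
      linear_combination (-50 + 80 * θ - 34 * θ ^ 2) * h.root
    have hν' : ¬ θ - 1 ∣ ν := h.not_dvd_add hmR (ht ▸ (Dvd.intro _ rfl).mul_left _)
    have hνeq : ((2 * k - m : ℤ) : R) + m * θ = (θ - 1) * ν := by
      rw [hν]
      push_cast
      linear_combination k * h.root
    set O : R := v * m * ν * (ν ^ 2 - (-1 - 3 * θ - θ ^ 2 - θ ^ 3) * m * ν +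
          (10 + 14 * θ + 4 * θ ^ 2 + 6 * θ ^ 3) * m ^ 2) with hO
    have hOodd : ¬ θ - 1 ∣ O := by
      refine h.not_dvd_mul (h.not_dvd_mul (h.not_dvd_mul hv' hmR) hν') ?_
      have := h.not_dvd_add (h.not_dvd_pow hν' 2) (y := (θ - 1) *
        (m ^ 2 * (1 + θ + θ ^ 3) * (θ - 1) ^ 3 * v ^ 2 - (θ + θ ^ 2) * (θ - 1) * v * m * ν))
        (Dvd.intro _ rfl)
      convert this using 2
      linear_combination -m * ν * ht1 + m ^ 2 * ht2
    obtain ⟨j, Z', hj, rfl, h2⟩ := h.eq_pow_mul_of_sq_eq (N := 6) hOodd (Z := Z) (by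
      rw [hZ, hνeq, hc, hO, ht1, ht2]
      ring)
    obtain rfl : j = 3 := by omega
    exact ⟨k, ν, Z', rfl, hν, hν', fun h' => hOodd (h2 ▸ h'.pow (by norm_num)), rfl, h2⟩
  · exfalso
    obtain ⟨k, m', hm', hmeq⟩ := h.exists_intCast_eq hm
    have hν : ¬ θ - 1 ∣ (n + m * θ : R) := by
      have := h.not_dvd_add (h.not_dvd_intCast hs) (y := (θ - 1) * m) (Dvd.intro _ rfl)
      push_cast at this
      convert this using 2
      ring
    set ν : R := n + m * θ
    have hodd : ¬ θ - 1 ∣ v * m' * ν * (ν ^ 2 - (θ + θ ^ 2) * c * m * ν +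
      (1 + θ + θ ^ 3) * c ^ 2 * m ^ 2) := by
      refine h.not_dvd_mul (h.not_dvd_mul (h.not_dvd_mul hv' hm') hν) ?_
      have := h.not_dvd_add (h.not_dvd_pow hν 2) (y := (θ - 1) * ((θ - 1) ^ 2 * v * m *
        ((1 + θ + θ ^ 3) * c * m - (θ + θ ^ 2) * ν))) (Dvd.intro _ rfl)
      convert this using 2
      linear_combination m * ((1 + θ + θ ^ 3) * c * m - (θ + θ ^ 2) * ν) * hc
    obtain ⟨j, -, hj, -⟩ := h.eq_pow_mul_of_sq_eq (N := 3 + 4 * k) hodd (Z := Z) (by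
      rw [hZ]
      linear_combination (ν * (ν ^ 2 - (θ + θ ^ 2) * c * m * ν +
        (1 + θ + θ ^ 3) * c ^ 2 * m ^ 2)) * (m * hc + (θ - 1) ^ 3 * v * hmeq))
    omega

end IsThetaRing

section Curve

variable {K : Type*} [Field K]

/-- The third intersection point of a line with the curve `y² = x³ - a x² + b x`. -/
theorem exists_point_of_line {a b x₁ y₁ x₂ y₂ : K} (h₁ : y₁ ^ 2 = x₁ ^ 3 - a * x₁ ^ 2 + b * x₁)
    (h₂ : y₂ ^ 2 = x₂ ^ 3 - a * x₂ ^ 2 + b * x₂) (hne : x₁ ≠ x₂) :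
    ∃ x y : K, y ^ 2 = x ^ 3 - a * x ^ 2 + b * x ∧
      x * (x₁ - x₂) ^ 2 = (x₁ * x₂ + b) * (x₁ + x₂) - 2 * a * x₁ * x₂ - 2 * y₁ * y₂ := by
  have hd : x₁ - x₂ ≠ 0 := sub_ne_zero.2 hne
  obtain ⟨l, hl⟩ : ∃ l, l * (x₁ - x₂) = y₁ - y₂ := ⟨_, div_mul_cancel₀ _ hd⟩
  refine ⟨a + l ^ 2 - x₁ - x₂, l * (a + l ^ 2 - x₁ - x₂ - x₁) + y₁, mul_left_cancel₀ hd ?_, ?_⟩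
  · linear_combination (a + l ^ 2 - x₁ - x₂ - x₂) * h₁ - (a + l ^ 2 - x₁ - x₂ - x₁) *
      (h₂ - (y₁ - l * (x₁ - x₂) + y₂) * hl)
  · linear_combination (l * (x₁ - x₂) + y₁ - y₂) * hl + h₁ + h₂

end Curve

section Descent

variable {R K : Type*} [CommRing R] [IsDomain R] [IsPrincipalIdealRing R] [Field K] [Algebra R K]
  [IsFractionRing R K]

theorem exists_algebraMap_eq_of_sq_eq {z : K} {x : R} (h : z ^ 2 = algebraMap R K x) :
    ∃ y : R, algebraMap R K y = z ∧ y ^ 2 = x := by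
  obtain ⟨y, rfl⟩ := IsIntegrallyClosed.exists_algebraMap_eq_of_isIntegral_pow (R := R)
    (n := 2) (by norm_num) (h ▸ isIntegral_algebraMap)
  exact ⟨y, rfl, IsFractionRing.injective R K (by rw [map_pow, h])⟩

namespace IsThetaRing

variable {θ : R}

/-- The curve has no point whose abscissa has an even denominator that is a power of four up to
an odd factor. -/
theorem false_of_four_pow_mul_eq (h : IsThetaRing θ) {a b x y : K}
    (ha : a = algebraMap R K (θ + θ ^ 2)) (hb : b = algebraMap R K (1 + θ + θ ^ 3))
    (hxy : y ^ 2 = x ^ 3 - a * x ^ 2 + b * x) {A B : R} (hA : ¬ θ - 1 ∣ A) (hB : ¬ θ - 1 ∣ B)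
    {j : ℕ} (hj : 1 ≤ j) (hx : 4 ^ j * algebraMap R K B * x = algebraMap R K A) : False := by
  obtain ⟨Z, -, hZ⟩ := exists_algebraMap_eq_of_sq_eq
    (z := y * (2 ^ j * (4 ^ j * algebraMap R K B ^ 2)))
    (x := A * B * (A ^ 2 - (θ + θ ^ 2) * A * (4 ^ j * B) + (1 + θ + θ ^ 3) * (4 ^ j * B) ^ 2)) (by
      have h24 : ((2 : K) ^ j) ^ 2 = 4 ^ j := by
        rw [← pow_mul, mul_comm, pow_mul]
        norm_num
      simp only [map_mul, map_add, map_sub, map_pow, map_ofNat, map_one, ← hx] at ha hb ⊢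
      rw [mul_pow, mul_pow, h24, hxy, ha, hb]
      ring)
  exact h.not_squareValue hj (h.squareValue_of_mul_eq_sq hj hA hB hZ)

end IsThetaRing
end Descent

namespace IsThetaRing

section Product

variable {R : Type*} [CommRing R] [IsDomain R] {θ : R}

theorem exists_eq_pow_mul_of_sq_eq (h : IsThetaRing θ) {n m l : ℤ} (hnm : IsCoprime n m)
    (hm : m ≠ 0) (hl : n - 3 * m = 8 * l) {c ν κ b Z : R} (hc : c = 3 - 3 * θ + θ ^ 2 - θ ^ 3)
    (hν : ν = n + m * θ) (hκ : κ = 3 + θ) (hb : b = 1 + θ + θ ^ 3)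
    (hZ : Z ^ 2 = c * m * ν * (ν ^ 2 - (θ + θ ^ 2) * c * m * ν + b * c ^ 2 * m ^ 2)) :
    ∃ σ u : R, σ ^ 2 = c * κ * (κ ^ 2 - (θ + θ ^ 2) * c * κ + b * c ^ 2) ∧ ¬ θ - 1 ∣ u ∧
      c * (ν * κ + b * m * c ^ 2) * (ν + κ * m) - 2 * (θ + θ ^ 2) * m * c ^ 2 * ν * κ - 2 * Z * σ =
        (θ - 1) ^ 14 * u := by
  have hG : (3 - 13 * θ - θ ^ 2 - 5 * θ ^ 3) ^ 2 =
      c * κ * (κ ^ 2 - (θ + θ ^ 2) * c * κ + b * c ^ 2) := by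
    rw [hc, hκ, hb]
    linear_combination (153 - 138 * θ + 170 * θ ^ 2 - 116 * θ ^ 3 + 71 * θ ^ 4 - 25 * θ ^ 5 +
      10 * θ ^ 6 + 2 * θ ^ 7 + θ ^ 9) * h.root
  obtain ⟨-, k, ν', Z', -, -, -, hZ', rfl, -⟩ := h.odd_of_sq_eq hnm hm hc (Z := Z) (by
    rw [hZ, hν, hb])
  obtain ⟨-, -, -, G, -, -, -, hG', hGeq, -⟩ := h.odd_of_sq_eq (n := 3) (m := 1)
    isCoprime_one_right one_ne_zero hc (Z := 3 - 13 * θ - θ ^ 2 - 5 * θ ^ 3) (by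
    rw [hG, hκ, hb]
    push_cast
    ring)
  set σ : R := 3 - 13 * θ - θ ^ 2 - 5 * θ ^ 3
  have hdiff : (n - 3 * m : R) = 8 * l := by exact_mod_cast congrArg (Int.cast : ℤ → R) hl
  obtain ⟨k, hk⟩ := h.dvd_two
  have h2 := two_eq_sub_one_pow_four h.root
  set w : R := 53 + 82 * θ + 22 * θ ^ 2 + 34 * θ ^ 3
  have hw : ¬ θ - 1 ∣ w := h.not_dvd_of_isUnit h.isUnit_w
  have hc3 := hc.trans h.slope_eq
  have h8 : (8 : R) = (θ - 1) ^ 12 * w ^ 3 := by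
    linear_combination (4 + 2 * ((θ - 1) ^ 4 * w) + ((θ - 1) ^ 4 * w) ^ 2) * h2
  have hκd : θ - 1 ∣ κ := ⟨1 + 2 * k, by linear_combination hκ + 2 * hk⟩
  have hνd : θ - 1 ∣ ν := by
    obtain ⟨y, hy⟩ := hκd
    exact ⟨m * y + (θ - 1) ^ 11 * w ^ 3 * l, by
      linear_combination hν + hdiff + m * hy - m * hκ + l * h8⟩
  have hcd : θ - 1 ∣ c := hc3 ▸ (dvd_pow_self _ (by norm_num)).mul_right _
  have hd2 : (θ - 1) ^ 2 ∣ ν * κ - b * m * c ^ 2 :=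
    dvd_sub (sq (θ - 1) ▸ mul_dvd_mul hνd hκd) ((pow_dvd_pow_of_dvd hcd 2).mul_left _)
  have hd17 : (θ - 1) ^ 17 ∣ c * (ν * κ - b * m * c ^ 2) * (n - 3 * m) := by
    obtain ⟨y, hy⟩ := hd2
    rw [hy, hdiff, h8, hc3]
    exact Dvd.intro ((-12 - 17 * θ - 5 * θ ^ 2 - 7 * θ ^ 3) * y * (w ^ 3 * l)) (by ring)
  have hd : (θ - 1) ^ (2 * 14 + 1) ∣
      (c * (ν * κ + b * m * c ^ 2) * (ν + κ * m) - 2 * (θ + θ ^ 2) * m * c ^ 2 * ν * κ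
          - 2 * ((θ - 1) ^ 3 * Z') * -σ) *
        (c * (ν * κ + b * m * c ^ 2) * (ν + κ * m) - 2 * (θ + θ ^ 2) * m * c ^ 2 * ν * κ
          - 2 * ((θ - 1) ^ 3 * Z') * σ) := by
    have := (pow_dvd_pow (θ - 1) (by norm_num : 2 * 14 + 1 ≤ 17 * 2)).trans
      (pow_mul (θ - 1) 17 2 ▸ pow_dvd_pow_of_dvd hd17 2)
    convert this using 1
    have hνκ : (n - 3 * m : R) = ν - κ * m := by rw [hν, hκ]; ring
    rw [hνκ]
    linear_combination -4 * σ ^ 2 * hZ - 4 * (c * m * ν *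
      (ν ^ 2 - (θ + θ ^ 2) * c * m * ν + b * c ^ 2 * m ^ 2)) * hG
  rcases h.exists_eq_pow_mul_of_sub_eq (O := w ^ 2 * Z' * G)
    (h.not_dvd_mul (h.not_dvd_mul (h.not_dvd_pow hw 2) hZ') hG') (by
      rw [hGeq]
      linear_combination (θ - 1) ^ 6 * Z' * G * h.four_eq) hd with ⟨u, hu, hueq⟩ | ⟨u, hu, hueq⟩
  · exact ⟨-σ, u, by rw [neg_sq, hG], hu, hueq⟩
  · exact ⟨σ, u, hG, hu, hueq⟩

end Product

variable {R K : Type*} [CommRing R] [IsDomain R] [IsPrincipalIdealRing R] [Field K] [Algebra R K]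
  [IsFractionRing R K] {θ : R}

theorem eq_three_mul (h : IsThetaRing θ) [CharZero K] {n m : ℤ} (hnm : IsCoprime n m) (hm : m ≠ 0)
    (h8 : 8 ∣ n - 3 * m) {a b c x y : K} {Z : R} (ha : a = algebraMap R K (θ + θ ^ 2))
    (hb : b = algebraMap R K (1 + θ + θ ^ 3))
    (hc : c = algebraMap R K (3 - 3 * θ + θ ^ 2 - θ ^ 3))
    (hxy : y ^ 2 = x ^ 3 - a * x ^ 2 + b * x) (hx : c * m * x = algebraMap R K (n + m * θ))
    (hZ : algebraMap R K Z = y * (m * c) ^ 2) : n = 3 * m := by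
  by_contra hne
  obtain ⟨l, hl⟩ := h8
  have hinj : Function.Injective (algebraMap R K) := IsFractionRing.injective R K
  have hmK : (m : K) ≠ 0 := by exact_mod_cast hm
  have hπ : algebraMap R K (θ - 1) ≠ 0 := (map_ne_zero_iff _ hinj).2 h.prime.ne_zero
  have hc3 := hc.trans (congrArg _ h.slope_eq)
  have h4 := congrArg (algebraMap R K) h.four_eq
  set v : R := -12 - 17 * θ - 5 * θ ^ 2 - 7 * θ ^ 3
  set w : R := 53 + 82 * θ + 22 * θ ^ 2 + 34 * θ ^ 3
  have hcne : c ≠ 0 := by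
    rw [hc3, map_ne_zero_iff _ hinj]
    exact mul_ne_zero (pow_ne_zero 3 h.prime.ne_zero) h.isUnit_v.ne_zero
  have hZ2 : algebraMap R K Z ^ 2 = c * m * (c * m * x) *
      ((c * m * x) ^ 2 - a * c * m * (c * m * x) + b * c ^ 2 * m ^ 2) := by
    rw [hZ]
    linear_combination (m * c) ^ 4 * hxy
  obtain ⟨σ, u, hσ, hu, hueq⟩ := h.exists_eq_pow_mul_of_sq_eq (Z := Z) hnm hm hl rfl rfl rfl rfl (by
    apply hinj
    rw [hx, ha, hb, hc] at hZ2
    simpa only [map_add, map_sub, map_mul, map_pow, map_intCast] using hZ2)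
  set κ := algebraMap R K (3 + θ) with hκ
  replace hσ := congrArg (algebraMap R K) hσ
  replace hueq := congrArg (algebraMap R K) hueq
  have hxn : c * m * x - m * κ = n - 3 * m := by
    rw [hx, hκ]
    simp only [map_add, map_mul, map_intCast, map_ofNat]
    ring
  have hσ' : algebraMap R K σ ^ 2 = c * κ * (κ ^ 2 - a * c * κ + b * c ^ 2) := by
    rw [hκ, ha, hb, hc]
    simpa only [map_add, map_sub, map_mul, map_pow] using hσ
  have hueq' : c * (c * m * x * κ + b * m * c ^ 2) * (c * m * x + κ * m) -
      2 * a * m * c ^ 2 * (c * m * x) * κ - 2 * algebraMap R K Z * algebraMap R K σ =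
        algebraMap R K (θ - 1) ^ 14 * algebraMap R K u := by
    rw [hx, hκ, ha, hb, hc]
    simpa only [map_add, map_sub, map_mul, map_pow, map_ofNat, map_intCast] using hueq
  obtain ⟨X, Y, hXY, hX⟩ := exists_point_of_line (x₂ := κ / c) (y₂ := algebraMap R K σ / c ^ 2) hxy
    (by
      field_simp
      linear_combination hσ')
    (by
      rintro rfl
      field_simp at hxn
      apply hne
      have : (n : K) = 3 * m := by linear_combination -hxn
      exact_mod_cast this)
  have hXu : X * (c * (n - 3 * m)) ^ 2 = algebraMap R K (θ - 1) ^ 14 * algebraMap R K u := by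
    rw [← hueq', ← hxn, hZ]
    field_simp at hX ⊢
    linear_combination hX
  have hl0 : l ≠ 0 := by
    rintro rfl
    omega
  obtain ⟨i, l, rfl, hlodd⟩ := exists_eq_two_pow_mul_odd hl0
  refine h.false_of_four_pow_mul_eq ha hb hXY hu (B := v ^ 2 * w ^ 2 * l ^ 2) (j := i + 2)
    (h.not_dvd_mul (h.not_dvd_mul (h.not_dvd_pow (h.not_dvd_of_isUnit h.isUnit_v) 2)
      (h.not_dvd_pow (h.not_dvd_of_isUnit h.isUnit_w) 2))
      (h.not_dvd_pow (h.not_dvd_intCast hlodd) 2))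
    (by omega) (mul_left_cancel₀ (pow_ne_zero 14 hπ) ?_)
  have hlK : (n - 3 * m : K) = 8 * (2 ^ i * l) := by exact_mod_cast congrArg (Int.cast : ℤ → K) hl
  rw [← hXu, hlK, hc3]
  have h24 : (4 : K) ^ i = (2 ^ i) ^ 2 := by
    rw [← pow_mul, mul_comm, pow_mul]
    norm_num
  simp only [map_mul, map_pow, map_intCast, map_ofNat] at h4 ⊢
  rw [pow_add, h24]
  linear_combination -(16 * (2 ^ i * l) ^ 2 * algebraMap R K (θ -
    1) ^ 6 * algebraMap R K v ^ 2 * X) * h4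

end IsThetaRing

section Slope

open NumberField

theorem zmod_four_eq_two_of_sq : ∀ m k a b c d : ZMod 4, m = 1 ∨ m = 3 →
    3 * m ^ 4 + k * m ^ 3 + 2 * k ^ 2 * m ^ 2 = a ^ 2 + c ^ 2 + 2 * b * d - 2 * d ^ 2 →
    2 * m ^ 4 + 3 * k * m ^ 3 = 2 * a * b + 2 * c * d →
    3 * k * m ^ 3 + 2 * k ^ 2 * m ^ 2 = b ^ 2 + 2 * a * c - 2 * c ^ 2 + d ^ 2 →
    2 * m ^ 4 + k * m ^ 3 = 2 * a * d + 2 * b * c → k = 2 := by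
  decide +kernel

variable {K : Type*} [Field K] [NumberField K] {θ : 𝓞 K}

theorem isThetaRing (hirr : Irreducible (X ^ 4 + 2 * X ^ 2 - 1 : ℚ[X]))
    (hθ : θ ^ 4 + 2 * θ ^ 2 - 1 = 0) (hgen : Algebra.adjoin ℚ {(θ : K)} = ⊤) : IsThetaRing θ where
  root := hθ
  prime := prime_sub_one hirr hθ hgen
  dvd_or_dvd_sub_one := sub_one_dvd_or hirr hθ hgen
  exists_unit_sq ε _ h := exists_sq_of_four_dvd_sub_sq hirr hθ hgen ε h

theorem eight_dvd_of_sq_eq (hirr : Irreducible (X ^ 4 + 2 * X ^ 2 - 1 : ℚ[X]))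
    (hθ : θ ^ 4 + 2 * θ ^ 2 - 1 = 0) (hgen : Algebra.adjoin ℚ {(θ : K)} = ⊤) {n m : ℤ}
    (hnm : IsCoprime n m) (hm : m ≠ 0) {c Z : 𝓞 K} (hc : c = 3 - 3 * θ + θ ^ 2 - θ ^ 3)
    (hZ : Z ^ 2 = c * m * (n + m * θ) * ((n + m * θ) ^ 2 - (θ + θ ^ 2) * c * m * (n + m * θ) +
      (1 + θ + θ ^ 3) * c ^ 2 * m ^ 2)) : 8 ∣ n - 3 * m := by
  obtain ⟨hmodd, k, ν, Z', rfl, hν, -, -, -, hZ'⟩ :=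
    (isThetaRing hirr hθ hgen).odd_of_sq_eq hnm hm hc hZ
  obtain ⟨a, b, c, d, h0, h1, h2, h3⟩ := coords_of_four_dvd_sub_sq hirr hθ hgen
    (-309 * m ^ 4 + 2093 * k * m ^ 3 - 2390 * k ^ 2 * m ^ 2 + 2028 * k ^ 3 * m)
    (-478 * m ^ 4 + 3247 * k * m ^ 3 - 3708 * k ^ 2 * m ^ 2 + 3148 * k ^ 3 * m)
    (-128 * m ^ 4 + 867 * k * m ^ 3 - 990 * k ^ 2 * m ^ 2 + 840 * k ^ 3 * m)
    (-198 * m ^ 4 + 1345 * k * m ^ 3 - 1536 * k ^ 2 * m ^ 2 + 1304 * k ^ 3 * m) (y := Z') ⟨0, by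
      rw [hZ', hν]
      push_cast
      linear_combination -((-165 - 70 * θ - 49 * θ ^ 2) * m ^ 4 + (1553 + 1222 * θ + 847 * θ ^ 2 +
        444 * θ ^ 3 + 138 * θ ^ 4 + 56 * θ ^ 5) * k * m ^ 3 + (-1958 - 1908 * θ - 1567 * θ ^ 2 -
        1074 * θ ^ 3 - 580 * θ ^ 4 - 274 * θ ^ 5 - 102 * θ ^ 6 - 26 * θ ^ 7 -
        7 * θ ^ 8) * k ^ 2 * m ^ 2 + (1704 + 1717 * θ + 1440 * θ ^ 2 + 1012 * θ ^ 3 +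
        561 * θ ^ 4 + 267 * θ ^ 5 + 102 * θ ^ 6 + 26 * θ ^ 7 + 7 * θ ^ 8) * k ^ 3 * m) * hθ⟩
  have h4 : (4 : ZMod 4) = 0 := rfl
  push_cast at h0 h1 h2 h3
  have hm4 : (m : ZMod 4) = 1 ∨ (m : ZMod 4) = 3 := by
    have hmod : m % 4 = 1 ∨ m % 4 = 3 := by
      obtain ⟨r, rfl⟩ := hmodd
      omega
    rcases hmod with h | h
    · left
      have := (ZMod.intCast_eq_intCast_iff m 1 4).2 h
      exact_mod_cast this
    · right
      have := (ZMod.intCast_eq_intCast_iff m 3 4).2 h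
      exact_mod_cast this
  have hk := zmod_four_eq_two_of_sq m k a b c d hm4
    (by linear_combination h0 + (78 * m ^ 4 - 523 * k * m ^ 3 + 598 * k ^ 2 * m ^ 2
      - 507 * k ^ 3 * m) * h4)
    (by linear_combination h1 + (120 * m ^ 4 - 811 * k * m ^ 3 + 927 * k ^ 2 * m ^ 2
      - 787 * k ^ 3 * m) * h4)
    (by linear_combination h2 + (32 * m ^ 4 - 216 * k * m ^ 3 + 248 * k ^ 2 * m ^ 2
      - 210 * k ^ 3 * m) * h4)
    (by linear_combination h3 + (50 * m ^ 4 - 336 * k * m ^ 3 + 384 * k ^ 2 * m ^ 2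
      - 326 * k ^ 3 * m) * h4)
  have hk' := (ZMod.intCast_eq_intCast_iff k 2 4).1 (by exact_mod_cast hk)
  have : k % 4 = 2 := hk'
  obtain ⟨r, rfl⟩ := hmodd
  omega

/-- A rational value of the slope map on the curve must be `3`. -/
theorem eq_three_of_point (hirr : Irreducible (X ^ 4 + 2 * X ^ 2 - 1 : ℚ[X])) {θ : K}
    (hθ : θ ^ 4 + 2 * θ ^ 2 - 1 = 0) (hgen : Algebra.adjoin ℚ {θ} = ⊤) {x y : K}
    (hxy : y ^ 2 = x ^ 3 - (θ + θ ^ 2) * x ^ 2 + (1 + θ + θ ^ 3) * x) {q : ℚ}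
    (hq : (q : K) = -θ + (3 - 3 * θ + θ ^ 2 - θ ^ 3) * x) : q = 3 := by
  obtain ⟨θ, rfl⟩ : ∃ θ' : 𝓞 K, algebraMap (𝓞 K) K θ' = θ := ⟨⟨θ, isIntegral_theta hθ⟩, rfl⟩
  replace hθ : θ ^ 4 + 2 * θ ^ 2 - 1 = 0 :=
    IsFractionRing.injective (𝓞 K) K (by simpa [map_ofNat] using hθ)
  have hprin := isPrincipalIdealRing hirr hθ hgen
  set c : 𝓞 K := 3 - 3 * θ + θ ^ 2 - θ ^ 3 with hc
  have hcK : algebraMap (𝓞 K) K c = 3 - 3 * algebraMap (𝓞 K) K θ + algebraMap (𝓞 K) K θ ^ 2 -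
      algebraMap (𝓞 K) K θ ^ 3 := by simp [hc, map_ofNat]
  have hden : (q.den : ℤ) ≠ 0 := by exact_mod_cast q.den_ne_zero
  have hcop : IsCoprime q.num q.den := Rat.isCoprime_num_den q
  have hqK : (q : K) * (q.den : ℤ) = q.num := by exact_mod_cast Rat.mul_den_eq_num q
  have hx : algebraMap (𝓞 K) K c * (q.den : ℤ) * x =
      algebraMap (𝓞 K) K (q.num + (q.den : ℤ) * θ) := by
    rw [hcK]
    simp only [map_add, map_mul, map_intCast]
    linear_combination hqK - (q.den : ℤ) * hq
  obtain ⟨Z, hZ, hZ2⟩ := exists_algebraMap_eq_of_sq_eq (R := 𝓞 K)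
    (z := y * ((q.den : ℤ) * algebraMap (𝓞 K) K c) ^ 2)
    (x := c * (q.den : ℤ) * (q.num + (q.den : ℤ) * θ) * ((q.num + (q.den : ℤ) * θ) ^ 2 -
      (θ + θ ^ 2) * c * (q.den : ℤ) * (q.num + (q.den : ℤ) * θ) +
        (1 + θ + θ ^ 3) * c ^ 2 * (q.den : ℤ) ^ 2)) (by
      simp only [map_mul _ (_ * _) _, map_mul _ c, map_sub _ (_ ^ 2), map_pow _ (_ + _), ← hx,
        map_add _ (_ - _) _]
      simp only [map_add, map_mul, map_pow, map_intCast, map_one]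
      linear_combination ((q.den : ℤ) * algebraMap (𝓞 K) K c) ^ 4 * hxy)
  have h3 := (isThetaRing hirr hθ hgen).eq_three_mul hcop hden
    (eight_dvd_of_sq_eq hirr hθ hgen hcop hden hc hZ2) (x := x) (y := y) rfl rfl rfl
    (by simpa using hxy) hx hZ
  rw [← Rat.num_div_den q, h3]
  have : (q.den : ℚ) ≠ 0 := by exact_mod_cast q.den_ne_zero
  push_cast
  field_simp

end Slope

section Points

variable {K : Type*} [Field K] {θ : K}

theorem E1_equation_iff {x y : K} : (E1 θ).Equation x y ↔
    y ^ 2 = x ^ 3 - (θ + θ ^ 2) * x ^ 2 + (1 + θ + θ ^ 3) * x := by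
  rw [WeierstrassCurve.Affine.equation_iff]
  simp only [E1, zero_mul, add_zero]
  rw [neg_mul, ← sub_eq_add_neg]

theorem E1_nonsingular [CharZero K] {x y : K} (hy : y ≠ 0)
    (h : y ^ 2 = x ^ 3 - (θ + θ ^ 2) * x ^ 2 + (1 + θ + θ ^ 3) * x) : (E1 θ).Nonsingular x y := by
  rw [WeierstrassCurve.Affine.nonsingular_iff]
  refine ⟨E1_equation_iff.2 h, .inr ?_⟩
  simp only [E1, zero_mul, sub_zero]
  intro h'
  exact hy (self_eq_neg.1 h')

variable [CharZero K]

theorem generator_equation (hθ : θ ^ 4 + 2 * θ ^ 2 - 1 = 0) :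
    ((-4 - 6 * θ - θ ^ 2 - 5 * θ ^ 3) / 2) ^ 2 =
    ((3 + 4 * θ + θ ^ 2) / 2) ^ 3 - (θ + θ ^ 2) * ((3 + 4 * θ + θ ^ 2) / 2) ^ 2 +
      (1 + θ + θ ^ 3) * ((3 + 4 * θ + θ ^ 2) / 2) := by
  linear_combination (7 + 22 * θ + 51 * θ ^ 2) / 8 * hθ

theorem generator_slope (hθ : θ ^ 4 + 2 * θ ^ 2 - 1 = 0) :
    3 = -θ + (3 - 3 * θ + θ ^ 2 - θ ^ 3) * ((3 + 4 * θ + θ ^ 2) / 2) := by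
  linear_combination (3 + θ) / 2 * hθ

theorem generator_ne_zero (hθ : θ ^ 4 + 2 * θ ^ 2 - 1 = 0) :
    (-4 - 6 * θ - θ ^ 2 - 5 * θ ^ 3) / 2 ≠ 0 := by
  intro h
  exact one_ne_zero (α := K) (by
    linear_combination (7 - 13 * θ + 3 * θ ^ 2 - 5 * θ ^ 3) / 7 * h -
      (42 - 10 * θ + 25 * θ ^ 2) / 14 * hθ)

theorem slope_ne_zero (hθ : θ ^ 4 + 2 * θ ^ 2 - 1 = 0) :
    3 - 3 * θ + θ ^ 2 - θ ^ 3 ≠ 0 := by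
  intro h
  exact one_ne_zero (α := K) (by linear_combination (1 + θ) / 2 * h + hθ / 2)

end Points

end ThetaField

open ThetaField

/-- Let `K₁ = ℚ(θ)` where `θ` is a root of the (irreducible) polynomial
`x⁴ + 2x² − 1`.  The affine points `(X, Y)` of `𝓔₁(K₁)` for which
`−θ + (3 − 3θ + θ² − θ³)·X` is a rational number are exactly
`G₁ = ((3 + 4θ + θ²)/2, (−4 − 6θ − θ² − 5θ³)/2)` and `−G₁`. -/
theorem E1_rational_X_points (K : Type*) [Field K] [Algebra ℚ K] (θ : K)
    (hirr : Irreducible (X ^ 4 + 2 * X ^ 2 - 1 : ℚ[X]))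
    (hθ : θ ^ 4 + 2 * θ ^ 2 - 1 = 0)
    (hgen : Algebra.adjoin ℚ {θ} = ⊤) :
    {P : K × K | (E1 θ).Nonsingular P.1 P.2 ∧
        ∃ q : ℚ, algebraMap ℚ K q = -θ + (3 - 3 * θ + θ ^ 2 - θ ^ 3) * P.1} =
      {((3 + 4 * θ + θ ^ 2) / 2, (-4 - 6 * θ - θ ^ 2 - 5 * θ ^ 3) / 2),
       ((3 + 4 * θ + θ ^ 2) / 2, (4 + 6 * θ + θ ^ 2 + 5 * θ ^ 3) / 2)} := by
  have : CharZero K := algebraRat.charZero K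
  obtain rfl : ‹Algebra ℚ K› = DivisionRing.toRatAlgebra := Subsingleton.elim _ _
  have : NumberField K :=
    { to_finiteDimensional := (powerBasis hirr hθ hgen).finite }
  have hG := generator_equation hθ
  have hslope := generator_slope hθ
  have hne := generator_ne_zero hθ
  ext ⟨x, y⟩
  simp only [Set.mem_ofPred_eq, Set.mem_insert_iff, Set.mem_singleton_iff, Prod.mk.injEq]
  constructor
  · rintro ⟨hns, q, hq⟩
    have hxy := E1_equation_iff.1 hns.1
    rw [eq_ratCast] at hq
    obtain rfl := eq_three_of_point hirr hθ hgen hxy hq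
    obtain rfl : x = (3 + 4 * θ + θ ^ 2) / 2 :=
      mul_left_cancel₀ (slope_ne_zero hθ) (by push_cast at hq; linear_combination hslope - hq)
    rcases sq_eq_sq_iff_eq_or_eq_neg.1 (hxy.trans hG.symm) with rfl | rfl
    · exact .inl ⟨rfl, rfl⟩
    · exact .inr ⟨rfl, by ring⟩
  · rintro (⟨rfl, rfl⟩ | ⟨rfl, rfl⟩)
    · exact ⟨E1_nonsingular hne hG, 3, by simpa using hslope⟩
    · refine ⟨E1_nonsingular (fun h => hne ?_) ?_, 3, by simpa using hslope⟩
      · linear_combination -h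
      · linear_combination hG
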